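/- Estimate of the discontinuity crossing probability: there exist a constant C ∈ (0,∞) and δ_0 ∈ (0,1) such that for every n ∈ ℕ with δ = T/n ∈ (0,δ_0) and every k ∈ {1,…,m}, it holds that E[ ( ∫_0^T 1_{{(x,y) ∈ ℝ² : (x−ζ_k)(y−ζ_k) ≤ 0}}(X^{(δ)}_{s̲}, X^{(δ)}_s) ds )^2 ] ≤ C δ. -/

import Mathlib

open MeasureTheory ProbabilityTheory

/-- Grid values of the Euler–Maruyama scheme with step size `δ` and initial value `x`. -/
noncomputable def emGrid {Ω : Type*} (μ σ ρ : ℝ → ℝ) (W N : ℝ → Ω → ℝ)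
    (δ : ℝ) (x : ℝ) : ℕ → Ω → ℝ
  | 0, _ => x
  | (j + 1), ω =>
      emGrid μ σ ρ W N δ x j ω
        + μ (emGrid μ σ ρ W N δ x j ω) * δ
        + σ (emGrid μ σ ρ W N δ x j ω) * (W (((j : ℝ) + 1) * δ) ω - W ((j : ℝ) * δ) ω)
        + ρ (emGrid μ σ ρ W N δ x j ω) * (N (((j : ℝ) + 1) * δ) ω - N ((j : ℝ) * δ) ω)

/-- The last grid point `t̲ = δ ⌊t/δ⌋` before time `t`. -/
noncomputable def lastGrid (δ t : ℝ) : ℝ := (⌊t / δ⌋.toNat : ℝ) * δ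

/-- The continuous-time Euler–Maruyama scheme
`X_t = X_t̲ + μ(X_t̲)(t - t̲) + σ(X_t̲)(W_t - W_t̲) + ρ(X_t̲)(N_t - N_t̲)`. -/
noncomputable def emProc {Ω : Type*} (μ σ ρ : ℝ → ℝ) (W N : ℝ → Ω → ℝ)
    (δ : ℝ) (x : ℝ) (t : ℝ) (ω : Ω) : ℝ :=
  emGrid μ σ ρ W N δ x (⌊t / δ⌋.toNat) ω
    + μ (emGrid μ σ ρ W N δ x (⌊t / δ⌋.toNat) ω) * (t - lastGrid δ t)
    + σ (emGrid μ σ ρ W N δ x (⌊t / δ⌋.toNat) ω) * (W t ω - W (lastGrid δ t) ω)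
    + ρ (emGrid μ σ ρ W N δ x (⌊t / δ⌋.toNat) ω) * (N t ω - N (lastGrid δ t) ω)

/-- The event `Z_k^t` that the Euler–Maruyama process at times `t̲` and `t` lies on
different sides of the point `ζk` (i.e. `(X_t̲ - ζk)(X_t - ζk) ≤ 0`). -/
def crossEvent {Ω : Type*} (μ σ ρ : ℝ → ℝ) (W N : ℝ → Ω → ℝ)
    (δ x ζk t : ℝ) : Set Ω :=
  {ω | (emProc μ σ ρ W N δ x (lastGrid δ t) ω - ζk) * (emProc μ σ ρ W N δ x t ω - ζk) ≤ 0}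



/-- Smoothed absolute value. -/
noncomputable def smAbs (ε u : ℝ) : ℝ := Real.sqrt (ε ^ 2 + u ^ 2)

lemma smAbs_sq (ε u : ℝ) : smAbs ε u ^ 2 = ε ^ 2 + u ^ 2 :=
  Real.sq_sqrt (by positivity)

lemma smAbs_nonneg (ε u : ℝ) : 0 ≤ smAbs ε u := Real.sqrt_nonneg _

lemma smAbs_ge_eps {ε : ℝ} (u : ℝ) : ε ≤ smAbs ε u :=
  Real.le_sqrt_of_sq_le (by nlinarith [sq_nonneg u])

lemma smAbs_ge_abs (ε u : ℝ) : |u| ≤ smAbs ε u :=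
  Real.le_sqrt_of_sq_le (by rw [sq_abs]; nlinarith [sq_nonneg ε])

lemma smAbs_pos {ε : ℝ} (hε : 0 < ε) (u : ℝ) : 0 < smAbs ε u := hε.trans_le (smAbs_ge_eps u)

lemma smAbs_le_add {ε : ℝ} (u w : ℝ) : smAbs ε w ≤ smAbs ε u + |w - u| := by
  apply Real.sqrt_le_iff.2
  have h0 := smAbs_nonneg ε u
  refine ⟨by positivity, ?_⟩
  have h1 := smAbs_sq ε u
  have h2 := smAbs_ge_abs ε u
  have h3 : |w| ≤ |u| + |w - u| := by
    calc |w| = |u + (w - u)| := by ring_nf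
      _ ≤ _ := abs_add_le _ _
  nlinarith [abs_nonneg w, abs_nonneg u, abs_nonneg (w - u), sq_abs w, sq_abs u,
    mul_nonneg (abs_nonneg (w-u)) (sub_nonneg.2 h2)]

lemma smAbs_abs_sub {ε : ℝ} (u w : ℝ) : |smAbs ε w - smAbs ε u| ≤ |w - u| := by
  rw [abs_le]
  have h1 := smAbs_le_add (ε := ε) u w
  have h2 := smAbs_le_add (ε := ε) w u
  rw [abs_sub_comm] at h2
  constructor <;> linarith

lemma smAbs_tangent {ε S : ℝ} (hε : 0 < ε) (hS : 0 ≤ S) (u w : ℝ) (hw : |w| ≤ S * ε) :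
    smAbs ε u + u * w / smAbs ε u + 1 / (4 * (1 + S) ^ 2) * (ε ^ 2 * w ^ 2 / smAbs ε u ^ 3)
      ≤ smAbs ε (u + w) := by
  have hv := smAbs_pos hε u
  have hsq := smAbs_sq ε u
  have hve := smAbs_ge_eps (ε := ε) u
  have hvu := smAbs_ge_abs ε u
  set v := smAbs ε u with hvdef
  apply Real.le_sqrt_of_sq_le
  set q := 1 / (4 * (1 + S) ^ 2) * (ε ^ 2 * w ^ 2 / v ^ 3) with hq
  have hq0 : 0 ≤ q := by positivity
  set b := ε ^ 2 * w ^ 2 / v ^ 2 with hb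
  have hb0 : 0 ≤ b := by positivity
  -- q * v = b/(4(1+S)^2)
  have hqv : q * v * (4 * (1 + S) ^ 2) = b := by
    rw [hq, hb]; field_simp
  have hwv : |w| ≤ S * v := hw.trans (by gcongr)
  have huw : u * w / v ≤ |w| := by
    rw [div_le_iff₀ hv]
    calc u * w ≤ |u * w| := le_abs_self _
      _ = |w| * |u| := by rw [abs_mul, mul_comm]
      _ ≤ |w| * v := by gcongr
  have hbv : b ≤ S ^ 2 * v ^ 2 := by
    rw [hb, div_le_iff₀ (by positivity)]
    have : w ^ 2 ≤ (S * v) ^ 2 := by rw [← sq_abs w]; gcongr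
    have h2 : ε ^ 2 ≤ v ^ 2 := by gcongr
    calc ε ^ 2 * w ^ 2 ≤ v ^ 2 * (S * v) ^ 2 := by gcongr
      _ = _ := by ring
  have hq2 : q ^ 2 ≤ b / 16 := by
    have hqle : q * v ≤ b / (4 * (1+S)^2) := by rw [le_div_iff₀ (by positivity)]; exact hqv.le
    have : (q * v) ^ 2 ≤ b / 16 * v ^ 2 := by
      calc (q * v) ^ 2 ≤ (b / (4 * (1+S)^2)) ^ 2 := by gcongr
        _ = b * b / (16 * ((1+S)^2)^2) := by field_simp; norm_num
        _ ≤ b * (S ^ 2 * v ^ 2) / (16 * ((1+S)^2)^2) := by gcongr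
        _ ≤ b / 16 * v ^ 2 := by
          rw [div_le_iff₀ (by positivity)]
          have : S ^ 2 ≤ ((1 + S) ^ 2) ^ 2 := by nlinarith [sq_nonneg S, mul_nonneg hS hS, pow_nonneg hS 3, pow_nonneg hS 4]
          calc b * (S ^ 2 * v ^ 2) ≤ b * (((1 + S) ^ 2) ^ 2 * v ^ 2) := by gcongr
            _ = _ := by ring
    rw [mul_pow] at this
    exact le_of_mul_le_mul_right this (by positivity)
  have hlin : 2 * q * (v + u * w / v) ≤ b / 2 := by
    have h1 : v + u * w / v ≤ (1 + S) * v := by linarith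
    have h2 : 2 * q * (v + u * w / v) ≤ 2 * q * ((1 + S) * v) := by gcongr
    have h3 : q * v * (1 + S) * 4 ≤ q * v * (4 * (1 + S) ^ 2) := by
      have : 0 ≤ q * v := by positivity
      nlinarith [mul_nonneg this hS, mul_nonneg (mul_nonneg this hS) hS]
    nlinarith
  have e1 : (u * w / v) ^ 2 + b = w ^ 2 := by
    rw [hb]; field_simp; rw [hsq]; ring
  have e2 : v * (u * w / v) = u * w := by field_simp
  nlinarith [hq2, hlin, e1, e2, hsq]

lemma smAbs_second_diff_nonneg {ε : ℝ} (hε : 0 < ε) (u y : ℝ) :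
    0 ≤ smAbs ε (u + y) + smAbs ε (u - y) - 2 * smAbs ε u := by
  have hv := smAbs_pos hε u
  have key : ∀ w, smAbs ε u + u * w / smAbs ε u ≤ smAbs ε (u + w) := by
    intro w
    apply Real.le_sqrt_of_sq_le
    have hsq := smAbs_sq ε u
    set v := smAbs ε u
    have e1 : (u * w / v) ^ 2 ≤ w ^ 2 := by
      rw [div_pow, div_le_iff₀ (by positivity), hsq]
      nlinarith [sq_nonneg (w * ε)]
    have e2 : v * (u * w / v) = u * w := by field_simp
    nlinarith
  have h1 := key y
  have h2 := key (-y)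
  rw [← sub_eq_add_neg, mul_neg, neg_div] at h2
  linarith

lemma smAbs_second_diff {ε S : ℝ} (hε : 0 < ε) (hS : 0 < S) (u y : ℝ) :
    2 * (1 / (4 * (1 + S) ^ 2)) * (ε ^ 2 / smAbs ε u ^ 3) * (y ^ 2 - y ^ 4 / (S ^ 2 * ε ^ 2))
      ≤ smAbs ε (u + y) + smAbs ε (u - y) - 2 * smAbs ε u := by
  have hv := smAbs_pos hε u
  by_cases hy : |y| ≤ S * ε
  · have h1 := smAbs_tangent hε hS.le u y hy
    have h2 := smAbs_tangent hε hS.le u (-y) (by rwa [abs_neg])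
    rw [← sub_eq_add_neg, mul_neg, neg_div, neg_sq] at h2
    set k := 1 / (4 * (1 + S) ^ 2)
    have hk : 0 ≤ k := by positivity
    have : 2 * k * (ε ^ 2 / smAbs ε u ^ 3) * (y ^ 2 - y ^ 4 / (S ^ 2 * ε ^ 2))
       ≤ 2 * k * (ε ^ 2 / smAbs ε u ^ 3) * (y ^ 2) := by
      gcongr
      have : 0 ≤ y ^ 4 / (S ^ 2 * ε ^ 2) := by positivity
      linarith
    have e : 2 * k * (ε ^ 2 / smAbs ε u ^ 3) * (y ^ 2) = 2 * (k * (ε ^ 2 * y ^ 2 / smAbs ε u ^ 3)) := by ring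
    linarith
  · push Not at hy
    refine le_trans ?_ (smAbs_second_diff_nonneg hε u y)
    apply mul_nonpos_of_nonneg_of_nonpos (by positivity)
    rw [sub_nonpos, le_div_iff₀ (by positivity)]
    have : (S * ε) ^ 2 ≤ y ^ 2 := by rw [← sq_abs y]; gcongr
    nlinarith [sq_nonneg y]

/-- Bounded Lyapunov function. -/
noncomputable def lyap (ε u : ℝ) : ℝ := smAbs ε u / (1 + smAbs ε u)

lemma lyap_nonneg (ε u : ℝ) : 0 ≤ lyap ε u := by
  have := smAbs_nonneg ε u
  unfold lyap; positivity

lemma lyap_le_one (ε u : ℝ) : lyap ε u ≤ 1 := by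
  have := smAbs_nonneg ε u
  unfold lyap
  rw [div_le_one (by positivity)]; linarith

lemma lyap_second_diff {ε : ℝ} (u y : ℝ) :
    (smAbs ε (u + y) + smAbs ε (u - y) - 2 * smAbs ε u - 2 * y ^ 2) / (1 + smAbs ε u) ^ 2
      ≤ lyap ε (u + y) + lyap ε (u - y) - 2 * lyap ε u := by
  have h0 := smAbs_nonneg ε u
  have h1 := smAbs_nonneg ε (u + y)
  have h2 := smAbs_nonneg ε (u - y)
  have d1 := smAbs_abs_sub (ε := ε) u (u + y)
  have d2 := smAbs_abs_sub (ε := ε) u (u - y)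
  have e1 : |u + y - u| = |y| := by ring_nf
  have e2 : |u - y - u| = |y| := by rw [show u - y - u = -y by ring, abs_neg]
  rw [e1] at d1
  rw [e2] at d2
  unfold lyap
  set v := smAbs ε u
  set a := smAbs ε (u + y)
  set b := smAbs ε (u - y)
  have s1 : (a - v) ^ 2 ≤ y ^ 2 := sq_le_sq.2 d1
  have s2 : (b - v) ^ 2 ≤ y ^ 2 := sq_le_sq.2 d2
  have key : a / (1 + a) + b / (1 + b) - 2 * (v / (1 + v)) =
      (a + b - 2 * v - (a - v) ^ 2 / (1 + a) - (b - v) ^ 2 / (1 + b)) / (1 + v) ^ 2 := by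
    field_simp; ring
  rw [key]
  gcongr ?_ / _
  have t1 : (a - v) ^ 2 / (1 + a) ≤ y ^ 2 := by
    rw [div_le_iff₀ (by positivity)]; nlinarith [sq_nonneg y]
  have t2 : (b - v) ^ 2 / (1 + b) ≤ y ^ 2 := by
    rw [div_le_iff₀ (by positivity)]; nlinarith [sq_nonneg y]
  linarith

lemma lyap_drift {ε κ : ℝ} (u w : ℝ) (hκ : |w - u| ≤ κ * (1 + |u|)) :
    lyap ε u - κ ≤ lyap ε w := by
  have h0 := smAbs_nonneg ε u
  have h1 := smAbs_nonneg ε w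
  have d := smAbs_le_add (ε := ε) w u
  rw [abs_sub_comm] at d
  have hu := smAbs_ge_abs ε u
  unfold lyap
  set v := smAbs ε u
  set a := smAbs ε w
  have hκ0 : 0 ≤ κ := by
    by_contra h
    push Not at h
    nlinarith [abs_nonneg u, abs_nonneg (w - u)]
  have e : v / (1 + v) - a / (1 + a) = (v - a) / ((1 + v) * (1 + a)) := by
    field_simp; ring
  have : (v - a) / ((1 + v) * (1 + a)) ≤ κ := by
    rw [div_le_iff₀ (by positivity)]
    calc v - a ≤ κ * (1 + |u|) := by linarith
      _ ≤ κ * (1 + v) := by gcongr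
      _ ≤ κ * ((1 + v) * (1 + a)) := by
        gcongr; nlinarith
  linarith

lemma smAbs_continuous (ε : ℝ) : Continuous (smAbs ε) := by
  unfold smAbs; fun_prop

lemma lyap_measurable (ε : ℝ) : Measurable (lyap ε) := by
  have := (smAbs_continuous ε).measurable
  unfold lyap; fun_prop

set_option maxHeartbeats 2000000 in
/-- Deterministic core of the argument. -/
lemma det_core (μ σ : ℝ → ℝ) (hμm : Measurable μ) (hσm : Measurable σ) (ζ K M : ℝ) (hK : 1 ≤ K)
    (hM : 1 ≤ M) (hμ : ∀ x, |μ x| ≤ K * (1 + |x - ζ|)) (hσ : ∀ x, |σ x| ≤ K * (1 + |x - ζ|))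
    (hσc : Continuous σ) (hσζ : σ ζ ≠ 0) :
    ∃ C ε0 : ℝ, 0 < C ∧ 0 < ε0 ∧ ε0 ≤ 1 ∧ ∀ ε, 0 < ε → ε < ε0 →
      ∃ (H f : ℝ → ℝ) (Hb : ℝ), Measurable H ∧ Measurable f ∧ (∀ x, 0 ≤ H x) ∧ (∀ x, H x ≤ Hb) ∧
        (∀ x, 0 ≤ f x) ∧ (∀ x, f x ≤ 1) ∧
        (∀ x w, H x * (w ^ 2 - w ^ 4 / (2 * M * ε ^ 2)) - C * w ^ 2 - C * ε ^ 2 ≤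
          f (x + μ x * ε ^ 2 + σ x * w) + f (x + μ x * ε ^ 2 - σ x * w) - 2 * f x) ∧
        (∀ x θ w, 0 ≤ θ → θ ≤ ε ^ 2 → (x - ζ) * (x + μ x * θ + σ x * w - ζ) ≤ 0 →
          1 ≤ C * ε * H x * (1 + w ^ 4 / ε ^ 4) + C * (ε ^ 2 + w ^ 2)) := by
  have hc0 : 0 < |σ ζ| / 2 := by positivity
  obtain ⟨r, hr0, hr1, hr⟩ : ∃ r : ℝ, 0 < r ∧ r ≤ 1 ∧ ∀ x, |x - ζ| ≤ r → |σ ζ| / 2 ≤ |σ x| := by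
    have h1 : ∀ᶠ x in nhds ζ, |σ ζ| / 2 < |σ x| :=
      (hσc.abs.tendsto ζ).eventually (lt_mem_nhds (by linarith))
    obtain ⟨r, hr, h⟩ := Metric.eventually_nhds_iff.1 h1
    refine ⟨min (r / 2) 1, by positivity, min_le_right _ _, fun x hx => (h ?_).le⟩
    rw [Real.dist_eq]
    have := min_le_left (r / 2) 1
    linarith
  set c0 := |σ ζ| / 2 with hc0def
  set S := 4 * K * M with hS
  have hS0 : 0 < S := by positivity
  set c := 1 / (4 * (1 + S) ^ 2) with hc
  have hcpos : 0 < c := by positivity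
  set c1 := 2 * c * c0 ^ 2 / ((1 + 2 * K) ^ 3 * (3 + 2 * K) ^ 2) with hc1
  have hc1pos : 0 < c1 := by positivity
  set Q := K * (1 + 1 / r) with hQ
  have hQ0 : 0 < Q := by positivity
  set q := 1 + 2 * K with hq
  have hq0 : 0 < q := by positivity
  refine ⟨8 * K ^ 2 + 2 * K + 2 * Q ^ 2 + 8 * q ^ 3 / c1, 1 / (2 * K), by positivity,
    by positivity, ?_, ?_⟩
  · rw [div_le_one (by positivity)]; linarith
  intro ε hε hεlt
  have hε1 : ε < 1 := by
    refine hεlt.trans_le ?_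
    rw [div_le_one (by positivity)]; linarith
  have hKε : K * ε ^ 2 ≤ 1 / 2 := by
    rw [lt_div_iff₀ (by positivity)] at hεlt
    nlinarith
  set C := 8 * K ^ 2 + 2 * K + 2 * Q ^ 2 + 8 * q ^ 3 / c1 with hC
  have hCa : 8 * K ^ 2 ≤ C := by
    have : 0 ≤ 2 * K + 2 * Q ^ 2 + 8 * q ^ 3 / c1 := by positivity
    linarith
  have hCb : 2 * K ≤ C := by
    have : 0 ≤ 8 * K ^ 2 + 2 * Q ^ 2 + 8 * q ^ 3 / c1 := by positivity
    linarith
  have hCc : 2 * Q ^ 2 ≤ C := by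
    have : 0 ≤ 8 * K ^ 2 + 2 * K + 8 * q ^ 3 / c1 := by positivity
    linarith
  have hCd : 8 * q ^ 3 / c1 ≤ C := by
    have : 0 ≤ 8 * K ^ 2 + 2 * K + 2 * Q ^ 2 := by positivity
    linarith
  have hC0 : 0 < C := by positivity
  clear_value C
  have hsm : Measurable (smAbs ε) := (smAbs_continuous ε).measurable
  -- the drifted position
  let V : ℝ → ℝ := fun x => smAbs ε (x - ζ + μ x * ε ^ 2)
  have hVm : Measurable V := hsm.comp (by fun_prop)
  have hVpos : ∀ x, 0 < V x := fun x => smAbs_pos hε _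
  have hVε : ∀ x, ε ≤ V x := fun x => smAbs_ge_eps _
  let H : ℝ → ℝ := fun x =>
    if |x - ζ| ≤ r then 2 * c * (ε ^ 2 / V x ^ 3) * σ x ^ 2 / (1 + V x) ^ 2 else 0
  have hHm : Measurable H := by
    refine Measurable.ite ?_ (by fun_prop) (by fun_prop)
    exact measurableSet_le (by fun_prop) (by fun_prop)
  have hHlow : ∀ x, |x - ζ| ≤ r → c1 * (ε ^ 2 / smAbs ε (x - ζ) ^ 3) ≤ H x := by
    intro x hx
    simp only [H, if_pos hx]
    have hv := smAbs_pos hε (x - ζ)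
    have hve := smAbs_ge_eps (ε := ε) (x - ζ)
    have hle : V x ≤ smAbs ε (x - ζ) + 2 * K * ε ^ 2 := by
      have h1 := smAbs_le_add (ε := ε) (x - ζ) (x - ζ + μ x * ε ^ 2)
      have h2 : |x - ζ + μ x * ε ^ 2 - (x - ζ)| ≤ 2 * K * ε ^ 2 := by
        rw [add_sub_cancel_left, abs_mul, abs_of_nonneg (sq_nonneg ε)]
        gcongr
        refine (hμ x).trans ?_
        nlinarith
      exact h1.trans (by gcongr)
    have hle1 : V x ≤ (1 + 2 * K) * smAbs ε (x - ζ) := by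
      have : ε ^ 2 ≤ smAbs ε (x - ζ) := by nlinarith
      nlinarith
    have hle2 : 1 + V x ≤ 3 + 2 * K := by
      have h1 := smAbs_le_add (ε := ε) 0 (x - ζ)
      have h2 : smAbs ε 0 = ε := by
        unfold smAbs; rw [zero_pow (by norm_num), add_zero, Real.sqrt_sq hε.le]
      rw [h2, sub_zero] at h1
      have : ε ^ 2 ≤ 1 := by nlinarith
      nlinarith
    have hσ2 : c0 ^ 2 ≤ σ x ^ 2 := by
      rw [← sq_abs (σ x)]
      have := hr x hx
      gcongr
    have hVx := hVpos x
    calc c1 * (ε ^ 2 / smAbs ε (x - ζ) ^ 3)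
        = 2 * c * (ε ^ 2 / ((1 + 2 * K) * smAbs ε (x - ζ)) ^ 3) * c0 ^ 2 / (3 + 2 * K) ^ 2 := by
          rw [hc1, hq]; field_simp
      _ ≤ _ := by gcongr
  have hH0 : ∀ x, 0 ≤ H x := by
    intro x
    simp only [H]
    split_ifs
    · have := hVpos x
      positivity
    · exact le_rfl
  refine ⟨H, fun x => lyap ε (x - ζ), 2 * c * (ε ^ 2 / ε ^ 3) * (2 * K) ^ 2, hHm,
    (lyap_measurable ε).comp (by fun_prop), hH0, ?_, fun x => lyap_nonneg _ _,
    fun x => lyap_le_one _ _, ?_, ?_⟩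
  · intro x
    simp only [H]
    split_ifs with hx
    · have hVx := hVpos x
      have hσ2 : σ x ^ 2 ≤ (2 * K) ^ 2 := by
        rw [← sq_abs (σ x)]
        have : |σ x| ≤ 2 * K := (hσ x).trans (by nlinarith)
        gcongr
      calc _ ≤ 2 * c * (ε ^ 2 / V x ^ 3) * σ x ^ 2 / 1 := by
            gcongr
            nlinarith
        _ ≤ _ := by
            rw [div_one]
            have := hVε x
            gcongr
    · positivity
  · intro x w
    have hdrift := lyap_drift (ε := ε) (κ := K * ε ^ 2) (x - ζ) (x - ζ + μ x * ε ^ 2) (by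
      rw [add_sub_cancel_left, abs_mul, abs_of_nonneg (sq_nonneg ε)]
      nlinarith [hμ x, sq_nonneg ε])
    have h2 := lyap_second_diff (ε := ε) (x - ζ + μ x * ε ^ 2) (σ x * w)
    have h3 := smAbs_second_diff hε hS0 (x - ζ + μ x * ε ^ 2) (σ x * w)
    have h4 := smAbs_second_diff_nonneg hε (x - ζ + μ x * ε ^ 2) (σ x * w)
    have hVx := hVpos x
    change lyap ε _ - K * ε ^ 2 ≤ _ at hdrift
    have e1 : x + μ x * ε ^ 2 + σ x * w - ζ = x - ζ + μ x * ε ^ 2 + σ x * w := by ring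
    have e2 : x + μ x * ε ^ 2 - σ x * w - ζ = x - ζ + μ x * ε ^ 2 - σ x * w := by ring
    beta_reduce
    rw [e1, e2]
    set D := smAbs ε (x - ζ + μ x * ε ^ 2 + σ x * w) + smAbs ε (x - ζ + μ x * ε ^ 2 - σ x * w) -
      2 * smAbs ε (x - ζ + μ x * ε ^ 2) with hD
    have hVdef : smAbs ε (x - ζ + μ x * ε ^ 2) = V x := rfl
    rw [hVdef] at h2 h3
    rw [sub_div] at h2
    have hA : 2 * (σ x * w) ^ 2 / (1 + V x) ^ 2 ≤ C * w ^ 2 := by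
      rw [div_le_iff₀ (by positivity)]
      have hU : 1 + |x - ζ| ≤ 2 * (1 + V x) := by
        have t1 := smAbs_ge_abs ε (x - ζ + μ x * ε ^ 2)
        rw [hVdef] at t1
        have t2 : |x - ζ| ≤ |x - ζ + μ x * ε ^ 2| + |μ x * ε ^ 2| := by
          calc |x - ζ| = |(x - ζ + μ x * ε ^ 2) - μ x * ε ^ 2| := by ring_nf
            _ ≤ _ := abs_sub _ _
        have t3 : |μ x * ε ^ 2| ≤ 1 / 2 * (1 + |x - ζ|) := by
          rw [abs_mul, abs_of_nonneg (sq_nonneg ε)]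
          calc |μ x| * ε ^ 2 ≤ K * (1 + |x - ζ|) * ε ^ 2 := by gcongr; exact hμ x
            _ = K * ε ^ 2 * (1 + |x - ζ|) := by ring
            _ ≤ _ := by gcongr
        linarith
      have hσ2 : σ x ^ 2 ≤ (K * (2 * (1 + V x))) ^ 2 := by
        rw [← sq_abs (σ x)]
        have : |σ x| ≤ K * (2 * (1 + V x)) := (hσ x).trans (by gcongr)
        gcongr
      calc 2 * (σ x * w) ^ 2 = 2 * σ x ^ 2 * w ^ 2 := by ring
        _ ≤ 2 * (K * (2 * (1 + V x))) ^ 2 * w ^ 2 := by gcongr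
        _ = 8 * K ^ 2 * w ^ 2 * (1 + V x) ^ 2 := by ring
        _ ≤ _ := by gcongr
    have hB : H x * (w ^ 2 - w ^ 4 / (2 * M * ε ^ 2)) ≤ D / (1 + V x) ^ 2 := by
      simp only [H]
      split_ifs with hx
      · rw [le_div_iff₀ (by positivity)]
        refine le_trans ?_ h3
        have e : 2 * c * (ε ^ 2 / V x ^ 3) * σ x ^ 2 / (1 + V x) ^ 2 *
            (w ^ 2 - w ^ 4 / (2 * M * ε ^ 2)) * (1 + V x) ^ 2 =
            2 * c * (ε ^ 2 / V x ^ 3) * (σ x ^ 2 * (w ^ 2 - w ^ 4 / (2 * M * ε ^ 2))) := by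
          field_simp
        rw [e]
        gcongr
        have hσ2 : σ x ^ 2 ≤ (2 * K) ^ 2 := by
          rw [← sq_abs (σ x)]
          have : |σ x| ≤ 2 * K := (hσ x).trans (by nlinarith)
          gcongr
        have : (σ x * w) ^ 4 / (S ^ 2 * ε ^ 2) ≤ σ x ^ 2 * (w ^ 4 / (2 * M * ε ^ 2)) := by
          rw [div_le_iff₀ (by positivity)]
          have e : σ x ^ 2 * (w ^ 4 / (2 * M * ε ^ 2)) * (S ^ 2 * ε ^ 2) =
            σ x ^ 2 * w ^ 4 * (S ^ 2 / (2 * M)) := by field_simp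
          rw [e]
          calc (σ x * w) ^ 4 = σ x ^ 2 * w ^ 4 * σ x ^ 2 := by ring
            _ ≤ σ x ^ 2 * w ^ 4 * (2 * K) ^ 2 := by gcongr
            _ ≤ _ := by
              gcongr
              rw [le_div_iff₀ (by positivity), hS]
              have : M ≤ M ^ 2 := by nlinarith
              nlinarith [mul_le_mul_of_nonneg_left this (sq_nonneg K), sq_nonneg (K * M)]
        calc _ = (σ x * w) ^ 2 - σ x ^ 2 * (w ^ 4 / (2 * M * ε ^ 2)) := by ring
          _ ≤ _ := by linarith
      · rw [zero_mul]; positivity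
    have hCε : 2 * K * ε ^ 2 ≤ C * ε ^ 2 := by gcongr
    linarith
  · intro x θ w hθ0 hθ hcross
    have hU : |x - ζ| ≤ |μ x * θ + σ x * w| := by
      have h1 : (x - ζ) ^ 2 ≤ -((x - ζ) * (μ x * θ + σ x * w)) := by nlinarith
      have h2 : -((x - ζ) * (μ x * θ + σ x * w)) ≤ |x - ζ| * |μ x * θ + σ x * w| := by
        rw [← abs_mul]; exact neg_le_abs _
      by_contra hlt
      push Not at hlt
      have h3 : 0 < |x - ζ| := (abs_nonneg _).trans_lt hlt
      nlinarith [sq_abs (x - ζ)]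
    have hU2 : |x - ζ| ≤ K * (1 + |x - ζ|) * (ε ^ 2 + |w|) := by
      refine hU.trans ((abs_add_le _ _).trans ?_)
      rw [abs_mul, abs_mul, abs_of_nonneg hθ0, mul_add]
      have h1 := hμ x
      have h2 := hσ x
      gcongr
    by_cases hx : |x - ζ| ≤ r
    · have hlow := hHlow x hx
      have hv := smAbs_pos hε (x - ζ)
      have hv2 : smAbs ε (x - ζ) ≤ q * (ε + |w|) := by
        have h1 := smAbs_le_add (ε := ε) 0 (x - ζ)
        have h2 : smAbs ε 0 = ε := by
          unfold smAbs; rw [zero_pow (by norm_num), add_zero, Real.sqrt_sq hε.le]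
        rw [h2, sub_zero] at h1
        have h3 : |x - ζ| ≤ 2 * K * (ε + |w|) := by
          calc |x - ζ| ≤ K * (1 + |x - ζ|) * (ε ^ 2 + |w|) := hU2
            _ ≤ K * (1 + 1) * (ε + |w|) := by
              gcongr
              · linarith
              · nlinarith
            _ = _ := by ring
        rw [hq]
        nlinarith [abs_nonneg w]
      have hcube : smAbs ε (x - ζ) ^ 3 ≤ 8 * q ^ 3 * (ε ^ 3 * (1 + w ^ 4 / ε ^ 4)) := by
        have h1 : (ε + |w|) ^ 3 ≤ 8 * (ε ^ 3 * (1 + w ^ 4 / ε ^ 4)) := by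
          have e : ε ^ 3 * (1 + w ^ 4 / ε ^ 4) = ε ^ 3 + w ^ 4 / ε := by field_simp
          rw [e]
          by_cases hwε : |w| ≤ ε
          · have : 0 ≤ w ^ 4 / ε := by positivity
            calc (ε + |w|) ^ 3 ≤ (ε + ε) ^ 3 := by gcongr
              _ = 8 * ε ^ 3 := by ring
              _ ≤ _ := by linarith
          · push Not at hwε
            have h5 : |w| ^ 3 ≤ w ^ 4 / ε := by
              rw [le_div_iff₀ hε]
              have : w ^ 4 = |w| ^ 4 := by rw [← abs_pow, abs_of_nonneg (by positivity)]
              rw [this]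
              calc |w| ^ 3 * ε ≤ |w| ^ 3 * |w| := by gcongr
                _ = _ := by ring
            calc (ε + |w|) ^ 3 ≤ (|w| + |w|) ^ 3 := by gcongr
              _ = 8 * |w| ^ 3 := by ring
              _ ≤ _ := by
                have : 0 < ε ^ 3 := by positivity
                linarith
        calc smAbs ε (x - ζ) ^ 3 ≤ (q * (ε + |w|)) ^ 3 := by gcongr
          _ = q ^ 3 * (ε + |w|) ^ 3 := by ring
          _ ≤ q ^ 3 * (8 * (ε ^ 3 * (1 + w ^ 4 / ε ^ 4))) := by gcongr
          _ = _ := by ring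
      have hfin : 1 ≤ C * ε * H x * (1 + w ^ 4 / ε ^ 4) := by
        calc (1 : ℝ) ≤ 8 * q ^ 3 * (ε ^ 3 * (1 + w ^ 4 / ε ^ 4)) / smAbs ε (x - ζ) ^ 3 := by
              rw [le_div_iff₀ (by positivity), one_mul]; exact hcube
          _ = 8 * q ^ 3 / c1 * ε * (c1 * (ε ^ 2 / smAbs ε (x - ζ) ^ 3)) * (1 + w ^ 4 / ε ^ 4) := by
              field_simp
          _ ≤ C * ε * H x * (1 + w ^ 4 / ε ^ 4) := by gcongr
      have : 0 ≤ C * (ε ^ 2 + w ^ 2) := by positivity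
      linarith
    · push Not at hx
      have h1 : 1 ≤ Q * (ε ^ 2 + |w|) := by
        have hpos : 0 < |x - ζ| := hr0.trans hx
        have h2 : 1 + |x - ζ| ≤ |x - ζ| * (1 + 1 / r) := by
          have : 1 ≤ |x - ζ| * (1 / r) := by
            rw [mul_one_div, le_div_iff₀ hr0]; linarith
          linarith
        have h3 : |x - ζ| * 1 ≤ |x - ζ| * (Q * (ε ^ 2 + |w|)) := by
          calc |x - ζ| * 1 ≤ K * (1 + |x - ζ|) * (ε ^ 2 + |w|) := by rw [mul_one]; exact hU2
            _ ≤ K * (|x - ζ| * (1 + 1 / r)) * (ε ^ 2 + |w|) := by gcongr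
            _ = _ := by rw [hQ]; ring
        exact le_of_mul_le_mul_left h3 hpos
      have h2 : 1 ≤ C * (ε ^ 2 + w ^ 2) := by
        calc (1 : ℝ) ≤ (Q * (ε ^ 2 + |w|)) ^ 2 := one_le_pow₀ h1
          _ = Q ^ 2 * (ε ^ 2 + |w|) ^ 2 := by ring
          _ ≤ Q ^ 2 * (2 * (ε ^ 2 + w ^ 2)) := by
            gcongr
            have : ε ^ 4 ≤ ε ^ 2 := by nlinarith [sq_nonneg ε, mul_nonneg hε.le hε.le]
            nlinarith [sq_nonneg (ε ^ 2 - |w|), sq_abs w]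
          _ = 2 * Q ^ 2 * (ε ^ 2 + w ^ 2) := by ring
          _ ≤ _ := by gcongr
      have h3 : 0 ≤ C * ε * H x * (1 + w ^ 4 / ε ^ 4) := by
        have := hH0 x
        positivity
      linarith

lemma lip_growth (μ : ℝ → ℝ) (K : NNReal) (S : Set ℝ) (h : LipschitzOnWith K μ S) :
    ∃ A : ℝ, ∀ x ∈ S, |μ x| ≤ A * (1 + |x|) := by
  rcases S.eq_empty_or_nonempty with rfl | ⟨y, hy⟩
  · exact ⟨0, fun x hx => absurd hx (Set.notMem_empty x)⟩
  · refine ⟨K * (1 + |y|) + |μ y|, fun x hx => ?_⟩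
    have h1 := h.dist_le_mul x hx y hy
    rw [Real.dist_eq, Real.dist_eq] at h1
    have h2 : |μ x| ≤ |μ x - μ y| + |μ y| := by
      calc |μ x| = |(μ x - μ y) + μ y| := by ring_nf
        _ ≤ _ := abs_add_le _ _
    have h3 : |x - y| ≤ |x| + |y| := abs_sub _ _
    have hK := K.coe_nonneg
    nlinarith [abs_nonneg x, abs_nonneg y, abs_nonneg (μ y),
      mul_nonneg hK (abs_nonneg x), mul_nonneg hK (abs_nonneg y),
      mul_nonneg (mul_nonneg hK (abs_nonneg x)) (abs_nonneg y),
      mul_nonneg (abs_nonneg (μ y)) (abs_nonneg x), mul_le_mul_of_nonneg_left h3 hK]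

lemma piecewise_growth (μ : ℝ → ℝ) (m : ℕ) (hm : 0 < m) (ζ : Fin m → ℝ)
    (hμ_low : ∃ K : NNReal, LipschitzOnWith K μ (Set.Iio (ζ ⟨0, hm⟩)))
    (hμ_high : ∃ K : NNReal, LipschitzOnWith K μ (Set.Ioi (ζ ⟨m - 1, Nat.sub_lt hm one_pos⟩)))
    (hμ_mid : ∀ (k : Fin m) (h : (k : ℕ) + 1 < m),
      ∃ K : NNReal, LipschitzOnWith K μ (Set.Ioo (ζ k) (ζ ⟨(k : ℕ) + 1, h⟩))) :
    ∃ A : ℝ, 0 ≤ A ∧ ∀ x, |μ x| ≤ A * (1 + |x|) := by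
  obtain ⟨K1, h1⟩ := hμ_low
  obtain ⟨A1, h1⟩ := lip_growth _ _ _ h1
  obtain ⟨K2, h2⟩ := hμ_high
  obtain ⟨A2, h2⟩ := lip_growth _ _ _ h2
  have h3 : ∀ k : Fin m, ∃ A : ℝ, ∀ h : (k : ℕ) + 1 < m,
      ∀ x ∈ Set.Ioo (ζ k) (ζ ⟨(k : ℕ) + 1, h⟩), |μ x| ≤ A * (1 + |x|) := by
    intro k
    by_cases h : (k : ℕ) + 1 < m
    · obtain ⟨K, hK⟩ := hμ_mid k h
      obtain ⟨A, hA⟩ := lip_growth _ _ _ hK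
      exact ⟨A, fun _ => hA⟩
    · exact ⟨0, fun h' => absurd h' h⟩
  choose A3 h3 using h3
  obtain ⟨B3, hB3⟩ := Finite.exists_le A3
  obtain ⟨B4, hB4⟩ := Finite.exists_le (fun k => |μ (ζ k)|)
  refine ⟨|A1| + |A2| + |B3| + |B4|, by positivity, fun x => ?_⟩
  have hx0 : 0 ≤ 1 + |x| := by positivity
  have fin : ∀ A : ℝ, A ≤ |A1| + |A2| + |B3| + |B4| → |μ x| ≤ A * (1 + |x|) →
      |μ x| ≤ (|A1| + |A2| + |B3| + |B4|) * (1 + |x|) :=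
    fun A hA h => h.trans (by gcongr)
  have l1 := le_abs_self A1
  have l2 := le_abs_self A2
  have l3 := le_abs_self B3
  have l4 := le_abs_self B4
  have p1 := abs_nonneg A1
  have p2 := abs_nonneg A2
  have p3 := abs_nonneg B3
  have p4 := abs_nonneg B4
  by_cases hζx : ∃ k, x = ζ k
  · obtain ⟨k, rfl⟩ := hζx
    refine fin B4 (by linarith) ((hB4 k).trans ?_)
    have : 0 ≤ B4 := (abs_nonneg _).trans (hB4 k)
    nlinarith [abs_nonneg (ζ k)]
  push Not at hζx
  by_cases hlow : x < ζ ⟨0, hm⟩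
  · exact fin A1 (by linarith) (h1 x hlow)
  -- induction: either in a middle interval or above ζ j
  by_cases hmid : ∃ (k : Fin m) (h : (k : ℕ) + 1 < m), x ∈ Set.Ioo (ζ k) (ζ ⟨(k : ℕ) + 1, h⟩)
  · obtain ⟨k, h, hx⟩ := hmid
    refine fin (A3 k) (by linarith [hB3 k]) (h3 k h x hx)
  push Not at hmid
  have above : ∀ j (hj : j < m), ζ ⟨j, hj⟩ < x := by
    intro j
    induction j with
    | zero => exact fun hj => lt_of_le_of_ne (not_lt.1 hlow) (hζx _).symm
    | succ j ih =>
      intro hj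
      have h4 := ih (by omega)
      have h5 := hmid ⟨j, by omega⟩ hj
      by_contra hlt
      exact h5 ⟨h4, lt_of_le_of_ne (not_lt.1 hlt) (hζx _)⟩
  exact fin A2 (by linarith) (h2 x (above _ _))


/-- Fourth moment of the standard normal law, bounded below by one. -/
noncomputable def gM : ℝ := max 1 (∫ z, z ^ 4 ∂(gaussianReal 0 1))

lemma gM_ge_one : 1 ≤ gM := le_max_left _ _

lemma gauss_integrable_pow (τ : NNReal) (k : ℕ) :
    Integrable (fun z : ℝ => z ^ k) (gaussianReal 0 τ) := by
  have h := (memLp_id_gaussianReal' (μ := 0) (v := τ) (k : ENNReal) (by simp))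
  have h2 := h.integrable_norm_pow'
  refine h2.mono (by fun_prop) ?_
  filter_upwards with z
  simp

lemma gauss_second (τ : NNReal) : ∫ z, z ^ 2 ∂(gaussianReal 0 τ) = τ := by
  have h := variance_id_gaussianReal (μ := 0) (v := τ)
  rw [variance_eq_integral (by fun_prop)] at h
  simpa [integral_id_gaussianReal] using h

lemma gauss_fourth (τ : NNReal) : ∫ z, z ^ 4 ∂(gaussianReal 0 τ) ≤ gM * (τ : ℝ) ^ 2 := by
  have h := gaussianReal_map_const_mul (μ := 0) (v := 1) (Real.sqrt τ)
  have e : (NNReal.mk (Real.sqrt τ ^ 2) (sq_nonneg _)) * 1 = τ := by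
    ext; simp
  rw [mul_zero, e] at h
  rw [← h, integral_map (by fun_prop) (by fun_prop)]
  have : ∀ z : ℝ, (Real.sqrt τ * z) ^ 4 = (τ : ℝ) ^ 2 * z ^ 4 := by
    intro z
    rw [mul_pow, show Real.sqrt (τ : ℝ) ^ 4 = (Real.sqrt τ ^ 2) ^ 2 by ring, Real.sq_sqrt τ.coe_nonneg]
  simp_rw [this]
  rw [integral_const_mul, mul_comm]
  gcongr
  exact le_max_right _ _

set_option linter.unusedSectionVars false

section OneStep

variable {Ω : Type*} {G : MeasurableSpace Ω} {m0 : MeasurableSpace Ω} {P : Measure Ω} [IsProbabilityMeasure P]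

lemma rv_pow_integrable {w : Ω → ℝ} (hw : Measurable w) {τ : NNReal}
    (hlaw : P.map w = gaussianReal 0 τ) (k : ℕ) : Integrable (fun ω => w ω ^ k) P := by
  have h := gauss_integrable_pow τ k
  rw [← hlaw] at h
  exact h.comp_measurable hw

lemma rv_second {w : Ω → ℝ} (hw : Measurable w) {τ : NNReal}
    (hlaw : P.map w = gaussianReal 0 τ) : ∫ ω, w ω ^ 2 ∂P = τ := by
  rw [← gauss_second τ, ← hlaw, integral_map hw.aemeasurable (by fun_prop)]

lemma rv_fourth {w : Ω → ℝ} (hw : Measurable w) {τ : NNReal}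
    (hlaw : P.map w = gaussianReal 0 τ) : ∫ ω, w ω ^ 4 ∂P ≤ gM * (τ : ℝ) ^ 2 := by
  rw [← integral_map (μ := P) (φ := w) (f := fun z => z ^ 4) hw.aemeasurable (by fun_prop), hlaw]
  exact gauss_fourth τ

lemma indep_factor (hG : G ≤ m0) {w d : Ω → ℝ} (hw : Measurable w)
    (hd : Measurable d)
    (hind : Indep (MeasurableSpace.comap (fun ω => (w ω, d ω)) inferInstance) G P)
    {B : Ω → ℝ} (hB : Measurable[G] B) {φ : ℝ × ℝ → ℝ} (hφ : Measurable φ) :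
    ∫ ω, B ω * φ (w ω, d ω) ∂P = (∫ ω, B ω ∂P) * ∫ ω, φ (w ω, d ω) ∂P := by
  have h1 : IndepFun B (fun ω => φ (w ω, d ω)) P := by
    rw [IndepFun_iff_Indep]
    refine indep_of_indep_of_le hind.symm hB.comap_le ?_
    rintro s ⟨t, ht, rfl⟩
    exact ⟨φ ⁻¹' t, hφ ht, rfl⟩
  exact h1.integral_fun_mul_eq_mul_integral (hB.mono hG le_rfl).aestronglyMeasurable
    (hφ.comp (hw.prodMk hd)).aestronglyMeasurable

lemma indep_symm_law (hG : G ≤ m0) {w d : Ω → ℝ} (hw : Measurable w)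
    (hind : Indep (MeasurableSpace.comap (fun ω => (w ω, d ω)) inferInstance) G P)
    {τ : NNReal} (hlaw : P.map w = gaussianReal 0 τ)
    {Z : Ω → ℝ × ℝ} (hZ : Measurable[G] Z) {g : (ℝ × ℝ) × ℝ → ℝ} (hg : Measurable g) :
    ∫ ω, g (Z ω, w ω) ∂P = ∫ ω, g (Z ω, - w ω) ∂P := by
  have hZ0 : Measurable Z := hZ.mono hG le_rfl
  have h1 : IndepFun Z w P := by
    rw [IndepFun_iff_Indep]
    refine indep_of_indep_of_le hind.symm hZ.comap_le ?_
    rintro s ⟨t, ht, rfl⟩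
    exact ⟨Prod.fst ⁻¹' t, measurable_fst ht, rfl⟩
  have h2 : IndepFun Z (fun ω => - w ω) P := h1.comp measurable_id measurable_neg
  have e1 := h1.map_prod_eq_prod_map_map hZ0.aemeasurable hw.aemeasurable
  have e2 : P.map (fun ω => (Z ω, - w ω)) = (P.map Z).prod (P.map (fun ω => - w ω)) :=
    h2.map_prod_eq_prod_map_map hZ0.aemeasurable hw.neg.aemeasurable
  have e3 : P.map (fun ω => - w ω) = P.map w := by
    have : P.map (fun ω => - w ω) = (P.map w).map (fun x => -x) := by
      rw [Measure.map_map measurable_neg hw]; rfl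
    rw [this, hlaw, gaussianReal_map_neg, neg_zero]
  rw [e3, ← e1] at e2
  rw [← integral_map (μ := P) (φ := fun ω => (Z ω, w ω)) (f := g)
      (hZ0.prodMk hw).aemeasurable hg.aestronglyMeasurable,
    ← integral_map (μ := P) (φ := fun ω => (Z ω, - w ω)) (f := g)
      (hZ0.prodMk hw.neg).aemeasurable hg.aestronglyMeasurable, e2]

lemma bdd_integrable {B : Ω → ℝ} (hB : Measurable B) {b : ℝ} (hBb : ∀ ω, |B ω| ≤ b) :
    Integrable B P :=
  Integrable.of_bound hB.aestronglyMeasurable b (by filter_upwards with ω; exact hBb ω)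

lemma bdd_mul_integrable {B X : Ω → ℝ} (hB : Measurable B) {b : ℝ} (hBb : ∀ ω, |B ω| ≤ b)
    (hX : Integrable X P) : Integrable (fun ω => B ω * X ω) P :=
  hX.bdd_mul hB.aestronglyMeasurable (c := b) (by filter_upwards with ω; exact hBb ω)

lemma jump_prob {d : Ω → ℝ} (hd : Measurable d) {p : ℝ} (hp : P.real {ω | d ω ≠ 0} ≤ p) :
    ∫ ω, (if d ω ≠ 0 then (1 : ℝ) else 0) ∂P ≤ p := by
  have hm : MeasurableSet {ω | d ω ≠ 0} := (hd (measurableSet_singleton 0)).compl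
  have : (fun ω => if d ω ≠ 0 then (1 : ℝ) else 0) = Set.indicator {ω | d ω ≠ 0} 1 := by
    ext ω; simp [Set.indicator]
  rw [this, integral_indicator_one hm]
  exact hp

lemma step_lower (hG : G ≤ m0) {w d : Ω → ℝ} (hw : Measurable w)
    (hd : Measurable d)
    (hind : Indep (MeasurableSpace.comap (fun ω => (w ω, d ω)) inferInstance) G P)
    {ε L C : ℝ} (hε : 0 < ε) (hlaw : P.map w = gaussianReal 0 (Real.toNNReal (ε ^ 2)))
    (hp : P.real {ω | d ω ≠ 0} ≤ L * ε ^ 2)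
    {μ σ ρ : ℝ → ℝ} (hμ : Measurable μ) (hσ : Measurable σ) (hρ : Measurable ρ)
    {H f : ℝ → ℝ} {Hb : ℝ} (hH : Measurable H) (hf : Measurable f) (hH0 : ∀ x, 0 ≤ H x)
    (hHb : ∀ x, H x ≤ Hb) (hf0 : ∀ x, 0 ≤ f x) (hf1 : ∀ x, f x ≤ 1)
    (hkey : ∀ x w, H x * (w ^ 2 - w ^ 4 / (2 * gM * ε ^ 2)) - C * w ^ 2 - C * ε ^ 2 ≤
          f (x + μ x * ε ^ 2 + σ x * w) + f (x + μ x * ε ^ 2 - σ x * w) - 2 * f x)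
    {B Y : Ω → ℝ} (hB : Measurable[G] B) (hY : Measurable[G] Y) {b : ℝ} (hB0 : ∀ ω, 0 ≤ B ω)
    (hBb : ∀ ω, B ω ≤ b) :
    (∫ ω, B ω * f (Y ω) ∂P) + ε ^ 2 / 4 * (∫ ω, B ω * H (Y ω) ∂P)
        - (C + L) * ε ^ 2 * ∫ ω, B ω ∂P
      ≤ ∫ ω, B ω * f (Y ω + μ (Y ω) * ε ^ 2 + σ (Y ω) * w ω + ρ (Y ω) * d ω) ∂P := by
  have hgM := gM_ge_one
  have hB' : Measurable B := hB.mono hG le_rfl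
  have hY' : Measurable Y := hY.mono hG le_rfl
  have hBabs : ∀ ω, |B ω| ≤ b := fun ω => by rw [abs_of_nonneg (hB0 ω)]; exact hBb ω
  have hb : ∀ {g : Ω → ℝ}, Measurable g → (∀ ω, 0 ≤ g ω) → (∀ ω, g ω ≤ 1) →
      Integrable (fun ω => B ω * g ω) P := fun hg h0 h1 =>
    bdd_mul_integrable hB' hBabs (bdd_integrable hg (b := 1) fun ω => by
      rw [abs_of_nonneg (h0 ω)]; exact h1 ω)
  have hBH : ∀ ω, |B ω * H (Y ω)| ≤ b * Hb := fun ω => by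
    rw [abs_of_nonneg (mul_nonneg (hB0 ω) (hH0 _))]
    have := hB0 ω
    have := hH0 (Y ω)
    have := hBb ω
    have := hHb (Y ω)
    gcongr
    linarith
  have i2 := rv_pow_integrable hw hlaw 2
  have i4 := rv_pow_integrable hw hlaw 4
  have hτ : ((Real.toNNReal (ε ^ 2) : NNReal) : ℝ) = ε ^ 2 := Real.coe_toNNReal _ (by positivity)
  have m2 := rv_second hw hlaw
  have m4 := rv_fourth hw hlaw
  rw [hτ] at m2 m4
  -- jump removal
  have s1 : (∫ ω, B ω * f (Y ω + μ (Y ω) * ε ^ 2 + σ (Y ω) * w ω) ∂P) -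
      (∫ ω, B ω ∂P) * (L * ε ^ 2) ≤
      ∫ ω, B ω * f (Y ω + μ (Y ω) * ε ^ 2 + σ (Y ω) * w ω + ρ (Y ω) * d ω) ∂P := by
    have hjm : Measurable (fun ω => if d ω ≠ 0 then (1 : ℝ) else 0) :=
      Measurable.ite (hd (measurableSet_singleton 0)).compl measurable_const measurable_const
    have e := indep_factor (P := P) hG hw hd hind hB
      (φ := fun p => if p.2 ≠ 0 then (1 : ℝ) else 0)
      (Measurable.ite (measurable_snd (measurableSet_singleton 0)).compl measurable_const
        measurable_const)
    have e2 : (∫ ω, B ω ∂P) * (∫ ω, (if d ω ≠ 0 then (1 : ℝ) else 0) ∂P) ≤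
        (∫ ω, B ω ∂P) * (L * ε ^ 2) :=
      mul_le_mul_of_nonneg_left (jump_prob hd hp) (integral_nonneg hB0)
    simp only at e
    rw [← e] at e2
    have e3 : ∫ ω, B ω * f (Y ω + μ (Y ω) * ε ^ 2 + σ (Y ω) * w ω) ∂P ≤
        ∫ ω, (B ω * f (Y ω + μ (Y ω) * ε ^ 2 + σ (Y ω) * w ω + ρ (Y ω) * d ω) +
          B ω * (if d ω ≠ 0 then (1 : ℝ) else 0)) ∂P := by
      apply integral_mono
      · exact hb (by fun_prop) (fun _ => hf0 _) (fun _ => hf1 _)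
      · refine Integrable.add (f := fun ω => B ω * f (Y ω + μ (Y ω) * ε ^ 2 + σ (Y ω) * w ω +
          ρ (Y ω) * d ω)) (hb (by fun_prop) (fun _ => hf0 _) (fun _ => hf1 _)) (hb hjm ?_ ?_)
        · intro ω; split_ifs <;> norm_num
        · intro ω; split_ifs <;> norm_num
      · intro ω
        dsimp only
        rw [← mul_add]
        refine mul_le_mul_of_nonneg_left ?_ (hB0 ω)
        by_cases h : d ω = 0
        · simp [h]
        · simp only [ne_eq, h, not_false_eq_true, if_true]
          linarith [hf1 (Y ω + μ (Y ω) * ε ^ 2 + σ (Y ω) * w ω),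
            hf0 (Y ω + μ (Y ω) * ε ^ 2 + σ (Y ω) * w ω + ρ (Y ω) * d ω)]
    rw [integral_add (hb (by fun_prop) (fun _ => hf0 _) (fun _ => hf1 _)) (hb hjm ?_ ?_)] at e3
    · linarith
    · intro ω; split_ifs <;> norm_num
    · intro ω; split_ifs <;> norm_num
  -- symmetrisation
  have s2 : ∫ ω, B ω * f (Y ω + μ (Y ω) * ε ^ 2 + σ (Y ω) * w ω) ∂P =
      ∫ ω, B ω * f (Y ω + μ (Y ω) * ε ^ 2 - σ (Y ω) * w ω) ∂P := by
    have := indep_symm_law (P := P) hG hw hind hlaw (Z := fun ω => (B ω, Y ω)) (hB.prodMk hY)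
      (g := fun p => p.1.1 * f (p.1.2 + μ p.1.2 * ε ^ 2 + σ p.1.2 * p.2)) (by fun_prop)
    simp only [mul_neg, ← sub_eq_add_neg] at this
    exact this
  have jH : Integrable (fun ω => B ω * H (Y ω) * (w ω ^ 2 - w ω ^ 4 / (2 * gM * ε ^ 2))) P :=
    bdd_mul_integrable (by fun_prop) hBH (i2.sub (i4.div_const _))
  have jw : Integrable (fun ω => C * (B ω * w ω ^ 2)) P :=
    (bdd_mul_integrable hB' hBabs i2).const_mul C
  have jB : Integrable (fun ω => C * ε ^ 2 * B ω) P :=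
    (bdd_integrable hB' hBabs).const_mul _
  have jp : Integrable (fun ω => B ω * f (Y ω + μ (Y ω) * ε ^ 2 + σ (Y ω) * w ω)) P :=
    hb (by fun_prop) (fun _ => hf0 _) (fun _ => hf1 _)
  have jm : Integrable (fun ω => B ω * f (Y ω + μ (Y ω) * ε ^ 2 - σ (Y ω) * w ω)) P :=
    hb (by fun_prop) (fun _ => hf0 _) (fun _ => hf1 _)
  have jf : Integrable (fun ω => 2 * (B ω * f (Y ω))) P :=
    (hb (by fun_prop) (fun _ => hf0 _) (fun _ => hf1 _)).const_mul 2
  have jHw : Integrable (fun ω => B ω * H (Y ω) * (w ω ^ 2 - w ω ^ 4 / (2 * gM * ε ^ 2)) -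
      C * (B ω * w ω ^ 2)) P := jH.sub jw
  have jHwB : Integrable (fun ω => B ω * H (Y ω) * (w ω ^ 2 - w ω ^ 4 / (2 * gM * ε ^ 2)) -
      C * (B ω * w ω ^ 2) - C * ε ^ 2 * B ω) P := jHw.sub jB
  have jpm : Integrable (fun ω => B ω * f (Y ω + μ (Y ω) * ε ^ 2 + σ (Y ω) * w ω) +
        B ω * f (Y ω + μ (Y ω) * ε ^ 2 - σ (Y ω) * w ω)) P := jp.add jm
  have jpmf : Integrable (fun ω => B ω * f (Y ω + μ (Y ω) * ε ^ 2 + σ (Y ω) * w ω) +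
        B ω * f (Y ω + μ (Y ω) * ε ^ 2 - σ (Y ω) * w ω) - 2 * (B ω * f (Y ω))) P := jpm.sub jf
  have s3 : ∫ ω, (B ω * H (Y ω) * (w ω ^ 2 - w ω ^ 4 / (2 * gM * ε ^ 2)) - C * (B ω * w ω ^ 2)
      - C * ε ^ 2 * B ω) ∂P ≤
      ∫ ω, (B ω * f (Y ω + μ (Y ω) * ε ^ 2 + σ (Y ω) * w ω) +
        B ω * f (Y ω + μ (Y ω) * ε ^ 2 - σ (Y ω) * w ω) - 2 * (B ω * f (Y ω))) ∂P := by
    refine integral_mono jHwB jpmf ?_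
    intro ω
    have := mul_le_mul_of_nonneg_left (hkey (Y ω) (w ω)) (hB0 ω)
    dsimp only
    linarith
  rw [integral_sub jHw jB, integral_sub jH jw, integral_sub jpm jf,
    integral_add jp jm, ← s2, integral_const_mul, integral_const_mul, integral_const_mul] at s3
  have f1 := indep_factor (P := P) hG hw hd hind (B := fun ω => B ω * H (Y ω))
    (hB.mul (hH.comp hY)) (φ := fun p => p.1 ^ 2 - p.1 ^ 4 / (2 * gM * ε ^ 2)) (by fun_prop)
  have f2 := indep_factor (P := P) hG hw hd hind hB (φ := fun p => p.1 ^ 2) (by fun_prop)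
  simp only at f1 f2
  rw [integral_sub i2 (i4.div_const _), integral_div, m2] at f1
  rw [m2] at f2
  rw [f1, f2] at s3
  have hIH : 0 ≤ ∫ ω, B ω * H (Y ω) ∂P := integral_nonneg fun ω => mul_nonneg (hB0 ω) (hH0 _)
  have s4 : (∫ ω, B ω * H (Y ω) ∂P) * (ε ^ 2 / 2) ≤
      (∫ ω, B ω * H (Y ω) ∂P) * (ε ^ 2 - (∫ ω, w ω ^ 4 ∂P) / (2 * gM * ε ^ 2)) := by
    gcongr
    have : (∫ ω, w ω ^ 4 ∂P) / (2 * gM * ε ^ 2) ≤ ε ^ 2 / 2 := by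
      rw [div_le_iff₀ (by positivity)]
      calc _ ≤ gM * (ε ^ 2) ^ 2 := m4
        _ = _ := by ring
    linarith
  nlinarith [s1, s3, s4]

lemma step_cross (hG : G ≤ m0) {w d : Ω → ℝ} (hw : Measurable w)
    (hd : Measurable d)
    (hind : Indep (MeasurableSpace.comap (fun ω => (w ω, d ω)) inferInstance) G P)
    {ε L C ζ θ : ℝ} (hε : 0 < ε) (hC : 0 < C) (hθ0 : 0 ≤ θ) (hθ : θ ≤ ε ^ 2)
    (hlaw : P.map w = gaussianReal 0 (Real.toNNReal θ))
    (hp : P.real {ω | d ω ≠ 0} ≤ L * ε ^ 2)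
    {μ σ ρ : ℝ → ℝ} (hμ : Measurable μ) (hσ : Measurable σ) (hρ : Measurable ρ)
    {H : ℝ → ℝ} {Hb : ℝ} (hH : Measurable H) (hH0 : ∀ x, 0 ≤ H x)
    (hHb : ∀ x, H x ≤ Hb)
    (hkey : ∀ x θ w, 0 ≤ θ → θ ≤ ε ^ 2 → (x - ζ) * (x + μ x * θ + σ x * w - ζ) ≤ 0 →
          1 ≤ C * ε * H x * (1 + w ^ 4 / ε ^ 4) + C * (ε ^ 2 + w ^ 2))
    {B Y : Ω → ℝ} (hB : Measurable[G] B) (hY : Measurable[G] Y) {b : ℝ} (hB0 : ∀ ω, 0 ≤ B ω)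
    (hBb : ∀ ω, B ω ≤ b) :
    ∫ ω, B ω * (if (Y ω - ζ) * (Y ω + μ (Y ω) * θ + σ (Y ω) * w ω + ρ (Y ω) * d ω - ζ) ≤ 0
        then (1 : ℝ) else 0) ∂P
      ≤ C * ε * (1 + gM) * (∫ ω, B ω * H (Y ω) ∂P) + (2 * C + L) * ε ^ 2 * ∫ ω, B ω ∂P := by
  have hgM := gM_ge_one
  have hB' : Measurable B := hB.mono hG le_rfl
  have hY' : Measurable Y := hY.mono hG le_rfl
  have hBabs : ∀ ω, |B ω| ≤ b := fun ω => by rw [abs_of_nonneg (hB0 ω)]; exact hBb ω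
  have hb : ∀ {g : Ω → ℝ}, Measurable g → (∀ ω, 0 ≤ g ω) → (∀ ω, g ω ≤ 1) →
      Integrable (fun ω => B ω * g ω) P := fun hg h0 h1 =>
    bdd_mul_integrable hB' hBabs (bdd_integrable hg (b := 1) fun ω => by
      rw [abs_of_nonneg (h0 ω)]; exact h1 ω)
  have hBH : ∀ ω, |B ω * H (Y ω)| ≤ b * Hb := fun ω => by
    rw [abs_of_nonneg (mul_nonneg (hB0 ω) (hH0 _))]
    have := hB0 ω
    have := hH0 (Y ω)
    have := hBb ω
    have := hHb (Y ω)
    gcongr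
    linarith
  have i2 := rv_pow_integrable hw hlaw 2
  have i4 := rv_pow_integrable hw hlaw 4
  have hτ : ((Real.toNNReal θ : NNReal) : ℝ) = θ := Real.coe_toNNReal _ hθ0
  have m2 := rv_second hw hlaw
  have m4 := rv_fourth hw hlaw
  rw [hτ] at m2 m4
  have hjm : Measurable (fun ω => if d ω ≠ 0 then (1 : ℝ) else 0) :=
    Measurable.ite (hd (measurableSet_singleton 0)).compl measurable_const measurable_const
  have jj : Integrable (fun ω => B ω * (if d ω ≠ 0 then (1 : ℝ) else 0)) P := by
    refine hb hjm ?_ ?_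
    · intro ω; split_ifs <;> norm_num
    · intro ω; split_ifs <;> norm_num
  have jH : Integrable (fun ω => C * ε * (B ω * H (Y ω) * (1 + w ω ^ 4 / ε ^ 4))) P :=
    (bdd_mul_integrable (by fun_prop) hBH
      ((integrable_const 1).add (i4.div_const _))).const_mul _
  have jw : Integrable (fun ω => C * (B ω * (ε ^ 2 + w ω ^ 2))) P :=
    (bdd_mul_integrable hB' hBabs ((integrable_const _).add i2)).const_mul C
  have hcm : Measurable (fun ω => if (Y ω - ζ) * (Y ω + μ (Y ω) * θ + σ (Y ω) * w ω +
      ρ (Y ω) * d ω - ζ) ≤ 0 then (1 : ℝ) else 0) :=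
    Measurable.ite (measurableSet_le (by fun_prop) (by fun_prop)) measurable_const measurable_const
  have jHw : Integrable (fun ω => C * ε * (B ω * H (Y ω) * (1 + w ω ^ 4 / ε ^ 4)) +
      C * (B ω * (ε ^ 2 + w ω ^ 2))) P := jH.add jw
  have jHwj : Integrable (fun ω => C * ε * (B ω * H (Y ω) * (1 + w ω ^ 4 / ε ^ 4)) +
      C * (B ω * (ε ^ 2 + w ω ^ 2)) + B ω * (if d ω ≠ 0 then (1 : ℝ) else 0)) P := jHw.add jj
  have s3 : ∫ ω, B ω * (if (Y ω - ζ) * (Y ω + μ (Y ω) * θ + σ (Y ω) * w ω + ρ (Y ω) * d ω - ζ) ≤ 0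
        then (1 : ℝ) else 0) ∂P ≤
      ∫ ω, (C * ε * (B ω * H (Y ω) * (1 + w ω ^ 4 / ε ^ 4)) + C * (B ω * (ε ^ 2 + w ω ^ 2)) +
        B ω * (if d ω ≠ 0 then (1 : ℝ) else 0)) ∂P := by
    apply integral_mono (hb hcm ?_ ?_) jHwj
    · intro ω
      dsimp only
      have hBω := hB0 ω
      have hHω := hH0 (Y ω)
      have p1 : 0 ≤ C * ε * (B ω * H (Y ω) * (1 + w ω ^ 4 / ε ^ 4)) + C * (B ω * (ε ^ 2 + w ω ^ 2)) := by
        positivity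
      by_cases hd0 : d ω = 0
      · simp only [hd0, mul_zero, add_zero, ne_eq, not_true_eq_false, if_false]
        by_cases hc : (Y ω - ζ) * (Y ω + μ (Y ω) * θ + σ (Y ω) * w ω - ζ) ≤ 0
        · rw [if_pos hc]
          have := mul_le_mul_of_nonneg_left (hkey (Y ω) θ (w ω) hθ0 hθ hc) hBω
          linarith
        · rw [if_neg hc, mul_zero]
          exact p1
      · simp only [ne_eq, hd0, not_false_eq_true, if_true]
        split_ifs
        · linarith
        · linarith
    · intro ω; split_ifs <;> norm_num
    · intro ω; split_ifs <;> norm_num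
  rw [integral_add jHw jj, integral_add jH jw, integral_const_mul, integral_const_mul] at s3
  have f1 := indep_factor (P := P) hG hw hd hind (B := fun ω => B ω * H (Y ω))
    (hB.mul (hH.comp hY)) (φ := fun p => 1 + p.1 ^ 4 / ε ^ 4) (by fun_prop)
  have f2 := indep_factor (P := P) hG hw hd hind hB (φ := fun p => ε ^ 2 + p.1 ^ 2) (by fun_prop)
  have f3 := indep_factor (P := P) hG hw hd hind hB
      (φ := fun p => if p.2 ≠ 0 then (1 : ℝ) else 0)
      (Measurable.ite (measurable_snd (measurableSet_singleton 0)).compl measurable_const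
        measurable_const)
  simp only at f1 f2 f3
  rw [integral_add (integrable_const 1) (i4.div_const _), integral_div] at f1
  rw [integral_add (integrable_const _) i2, m2] at f2
  simp only [integral_const, probReal_univ, one_smul] at f1 f2
  rw [f1, f2, f3] at s3
  have hIH : 0 ≤ ∫ ω, B ω * H (Y ω) ∂P := integral_nonneg fun ω => mul_nonneg (hB0 ω) (hH0 _)
  have hIB : 0 ≤ ∫ ω, B ω ∂P := integral_nonneg hB0
  have t1 : C * ε * ((∫ ω, B ω * H (Y ω) ∂P) * (1 + (∫ ω, w ω ^ 4 ∂P) / ε ^ 4)) ≤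
      C * ε * ((∫ ω, B ω * H (Y ω) ∂P) * (1 + gM)) := by
    gcongr
    rw [div_le_iff₀ (by positivity)]
    calc _ ≤ gM * θ ^ 2 := m4
      _ ≤ gM * (ε ^ 2) ^ 2 := by gcongr
      _ = _ := by ring
  have t2 : C * ((∫ ω, B ω ∂P) * (ε ^ 2 + θ)) ≤ C * ((∫ ω, B ω ∂P) * (ε ^ 2 + ε ^ 2)) := by
    gcongr
  have t3 : (∫ ω, B ω ∂P) * (∫ ω, (if d ω ≠ 0 then (1 : ℝ) else 0) ∂P) ≤
        (∫ ω, B ω ∂P) * (L * ε ^ 2) :=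
      mul_le_mul_of_nonneg_left (jump_prob hd hp) hIB
  linarith

end OneStep

lemma exists_regular {Ω : Type*} {G : MeasurableSpace Ω} (V : ℝ → Ω → ℝ) (a b : ℝ) (hab : a < b)
    (hV : ∀ t ∈ Set.Icc a b, Measurable (V t)) :
    ∃ V' : ℝ × Ω → ℝ, Measurable V' ∧ ∀ ω, (∀ t ∈ Set.Ico a b,
      Filter.Tendsto (fun u => V u ω) (nhdsWithin t (Set.Ioi t)) (nhds (V t ω))) →
      ∀ s ∈ Set.Ico a b, V' (s, ω) = V s ω := by
  let r : ℕ → ℤ → ℝ := fun k z => max a (min b (((z : ℝ) + 1) / ((k : ℝ) + 1)))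
  have hr : ∀ k z, r k z ∈ Set.Icc a b := fun k z =>
    ⟨le_max_left _ _, max_le hab.le (min_le_left _ _)⟩
  let Vk : ℕ → ℝ × Ω → ℝ := fun k p => V (r k ⌊((k : ℝ) + 1) * p.1⌋) p.2
  have hVk : ∀ k, Measurable (Vk k) := by
    intro k
    have h1 : Measurable (fun q : ℤ × Ω => V (r k q.1) q.2) :=
      measurable_from_prod_countable_right fun z => hV _ (hr k z)
    have h2 : Measurable (fun p : ℝ × Ω => (⌊((k : ℝ) + 1) * p.1⌋, p.2)) := by
      refine Measurable.prodMk ?_ measurable_snd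
      exact Int.measurable_floor.comp (by fun_prop)
    exact h1.comp h2
  refine ⟨fun p => Filter.limsup (fun k => Vk k p) Filter.atTop, Measurable.limsup hVk, ?_⟩
  intro ω hω s hs
  refine Filter.Tendsto.limsup_eq ?_
  have hlim : Filter.Tendsto (fun k : ℕ => r k ⌊((k : ℝ) + 1) * s⌋) Filter.atTop
      (nhdsWithin s (Set.Ioi s)) := by
    refine tendsto_nhdsWithin_iff.2 ⟨?_, Filter.Eventually.of_forall ?_⟩
    · have hin : Filter.Tendsto (fun k : ℕ => (((⌊((k : ℝ) + 1) * s⌋ : ℤ) : ℝ) + 1) / ((k : ℝ) + 1))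
          Filter.atTop (nhds s) := by
        have h0 : Filter.Tendsto (fun k : ℕ => s + 1 / ((k : ℝ) + 1)) Filter.atTop (nhds (s + 0)) :=
          tendsto_const_nhds.add tendsto_one_div_add_atTop_nhds_zero_nat
        rw [add_zero] at h0
        refine tendsto_of_tendsto_of_tendsto_of_le_of_le tendsto_const_nhds h0 ?_ ?_
        · intro k
          have hk : (0 : ℝ) < (k : ℝ) + 1 := by positivity
          dsimp only
          rw [le_div_iff₀ hk]
          have := Int.lt_floor_add_one (((k : ℝ) + 1) * s)
          linarith
        · intro k
          have hk : (0 : ℝ) < (k : ℝ) + 1 := by positivity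
          dsimp only
          rw [div_le_iff₀ hk, add_mul s, one_div, inv_mul_cancel₀ hk.ne']
          have := Int.floor_le (((k : ℝ) + 1) * s)
          linarith
      have h3 := (tendsto_const_nhds (x := a)).max ((tendsto_const_nhds (x := b)).min hin)
      rw [min_eq_right hs.2.le, max_eq_right hs.1] at h3
      exact h3
    · intro k
      have hk : (0 : ℝ) < (k : ℝ) + 1 := by positivity
      refine lt_max_of_lt_right (lt_min hs.2 ?_)
      rw [lt_div_iff₀ hk]
      have := Int.lt_floor_add_one (((k : ℝ) + 1) * s)
      linarith
  exact (hω s hs).comp hlim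

lemma poisson_jump {Ω : Type*} {m0 : MeasurableSpace Ω} {P : Measure Ω} [IsProbabilityMeasure P]
    {d : Ω → ℝ} (hd : Measurable d) {r : NNReal}
    (hlaw : P.map d = Measure.map (fun k : ℕ => (k : ℝ)) (poissonMeasure r)) :
    P.real {ω | d ω ≠ 0} ≤ r := by
  have hm : MeasurableSet {ω | d ω = 0} := hd (measurableSet_singleton 0)
  have h1 : P.real {ω | d ω = 0} = Real.exp (-r) := by
    have e1 : P.real {ω | d ω = 0} = (P.map d).real {0} := by
      rw [map_measureReal_apply hd (measurableSet_singleton 0)]; rfl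
    rw [e1, hlaw, map_measureReal_apply (by fun_prop) (measurableSet_singleton 0)]
    have : (fun k : ℕ => (k : ℝ)) ⁻¹' {0} = {0} := by ext k; simp
    rw [this, poissonMeasure_real_singleton]
    simp
  have h2 : P.real {ω | d ω ≠ 0} = 1 - P.real {ω | d ω = 0} := by
    rw [← probReal_compl_eq_one_sub hm]; rfl
  rw [h2, h1]
  have := Real.add_one_le_exp (-(r : ℝ))
  linarith

lemma sum_square {Ω : Type*} {m0 : MeasurableSpace Ω} {P : Measure Ω} [IsProbabilityMeasure P]
    (G : ℕ → MeasurableSpace Ω) (hG : ∀ i, G i ≤ m0) (hmono : Monotone G) (n : ℕ)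
    (A f : ℕ → Ω → ℝ) {ε D D1 T : ℝ} (hε : 0 < ε) (hD1 : 0 ≤ D1) (hD1D : D1 ≤ D) (hD : 0 < D) (hT : (n : ℝ) * ε ^ 2 = T)
    (hA : ∀ j < n, Measurable[G (j + 1)] (A j))
    (hA0 : ∀ j ω, 0 ≤ A j ω) (hA1 : ∀ j ω, A j ω ≤ ε ^ 2)
    (hf : ∀ j ≤ n, Measurable (f j)) (hf0 : ∀ j ω, 0 ≤ f j ω) (hf1 : ∀ j ω, f j ω ≤ 1)
    (hstep : ∀ j < n, ∀ B : Ω → ℝ, Measurable[G j] B → (∀ ω, 0 ≤ B ω) → (∀ ω, B ω ≤ 1 + ε ^ 2) →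
      ∫ ω, B ω * A j ω ∂P ≤ D1 * ε * ((∫ ω, B ω * f (j + 1) ω ∂P) - ∫ ω, B ω * f j ω ∂P)
        + D * ε ^ 3 * ∫ ω, B ω ∂P) :
    ∫ ω, (∑ j ∈ Finset.range n, A j ω) ^ 2 ∂P ≤ (T + 2 * (D * (1 + T)) ^ 2) * ε ^ 2 := by
  have hAm : ∀ j < n, Measurable (A j) := fun j hj => (hA j hj).mono (hG _) le_rfl
  have hAabs : ∀ j ω, |A j ω| ≤ ε ^ 2 := fun j ω => by
    rw [abs_of_nonneg (hA0 j ω)]; exact hA1 j ω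
  have hT0 : 0 ≤ T := by rw [← hT]; positivity
  -- tail sums
  have tail : ∀ i ≤ n, ∀ B : Ω → ℝ, Measurable[G i] B → (∀ ω, 0 ≤ B ω) →
      (∀ ω, B ω ≤ 1 + ε ^ 2) →
      ∑ j ∈ Finset.Ico i n, ∫ ω, B ω * A j ω ∂P ≤ D * (1 + T) * ε * ∫ ω, B ω ∂P := by
    intro i hi B hB hB0 hB1
    have hBm : Measurable B := hB.mono (hG i) le_rfl
    have hBabs : ∀ ω, |B ω| ≤ 1 + ε ^ 2 := fun ω => by
      rw [abs_of_nonneg (hB0 ω)]; exact hB1 ω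
    have hIB : 0 ≤ ∫ ω, B ω ∂P := integral_nonneg hB0
    have h1 : ∑ j ∈ Finset.Ico i n, ∫ ω, B ω * A j ω ∂P ≤
        ∑ j ∈ Finset.Ico i n, (D1 * ε * ((∫ ω, B ω * f (j + 1) ω ∂P) - ∫ ω, B ω * f j ω ∂P)
        + D * ε ^ 3 * ∫ ω, B ω ∂P) := by
      refine Finset.sum_le_sum fun j hj => ?_
      rw [Finset.mem_Ico] at hj
      exact hstep j hj.2 B (hB.mono (hmono hj.1) le_rfl) hB0 hB1
    rw [Finset.sum_add_distrib, ← Finset.mul_sum, Finset.sum_const, Nat.card_Ico,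
      Finset.sum_Ico_sub (fun j => ∫ ω, B ω * f j ω ∂P) hi, nsmul_eq_mul] at h1
    have h2 : ∫ ω, B ω * f n ω ∂P ≤ ∫ ω, B ω ∂P := by
      refine integral_mono (bdd_mul_integrable hBm hBabs (bdd_integrable (hf n le_rfl) (b := 1)
        fun ω => by rw [abs_of_nonneg (hf0 n ω)]; exact hf1 n ω)) (bdd_integrable hBm hBabs) ?_
      intro ω
      exact mul_le_of_le_one_right (hB0 ω) (hf1 n ω)
    have h3 : 0 ≤ ∫ ω, B ω * f i ω ∂P := integral_nonneg fun ω => mul_nonneg (hB0 ω) (hf0 i ω)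
    have h4 : ((n - i : ℕ) : ℝ) ≤ n := by exact_mod_cast Nat.sub_le n i
    calc _ ≤ _ := h1
      _ ≤ D1 * ε * ((∫ ω, B ω ∂P) - 0) + n * (D * ε ^ 3 * ∫ ω, B ω ∂P) := by
          gcongr
      _ ≤ D * ε * ((∫ ω, B ω ∂P) - 0) + n * (D * ε ^ 3 * ∫ ω, B ω ∂P) := by
          rw [sub_zero]; gcongr
      _ = D * (1 + n * ε ^ 2) * ε * ∫ ω, B ω ∂P := by ring
      _ = _ := by rw [hT]
  -- square expansion
  have hsq : ∀ ω, ∀ k ≤ n, (∑ j ∈ Finset.Ico k n, A j ω) ^ 2 =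
      ∑ i ∈ Finset.Ico k n, (A i ω ^ 2 + 2 * ∑ j ∈ Finset.Ico (i + 1) n, A i ω * A j ω) := by
    intro ω k hk
    induction hk using Nat.decreasingInduction with
    | self => simp
    | of_succ k hk ih =>
      rw [Finset.sum_eq_sum_Ico_succ_bot hk, Finset.sum_eq_sum_Ico_succ_bot hk, ← ih,
        ← Finset.mul_sum]
      ring
  have hint2 : ∀ i < n, Integrable (fun ω => A i ω ^ 2) P := by
    intro i hi
    simp_rw [sq]
    exact bdd_mul_integrable (hAm i hi) (hAabs i) (bdd_integrable (hAm i hi) (hAabs i))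
  have hintm : ∀ i < n, ∀ j < n, Integrable (fun ω => A i ω * A j ω) P := fun i hi j hj =>
    bdd_mul_integrable (hAm i hi) (hAabs i) (bdd_integrable (hAm j hj) (hAabs j))
  have hE : ∫ ω, (∑ j ∈ Finset.range n, A j ω) ^ 2 ∂P =
      ∑ i ∈ Finset.range n, ((∫ ω, A i ω ^ 2 ∂P) +
        2 * ∑ j ∈ Finset.Ico (i + 1) n, ∫ ω, A i ω * A j ω ∂P) := by
    have : ∀ ω, (∑ j ∈ Finset.range n, A j ω) ^ 2 = ∑ i ∈ Finset.range n,
        (A i ω ^ 2 + 2 * ∑ j ∈ Finset.Ico (i + 1) n, A i ω * A j ω) := by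
      intro ω
      have := hsq ω 0 (Nat.zero_le _)
      rwa [← Finset.range_eq_Ico] at this
    simp_rw [this]
    have hs : ∀ i ∈ Finset.range n,
        Integrable (fun ω => 2 * ∑ j ∈ Finset.Ico (i + 1) n, A i ω * A j ω) P := by
      intro i hi
      refine Integrable.const_mul (integrable_finsetSum _ fun j hj => ?_) 2
      exact hintm i (Finset.mem_range.1 hi) j (Finset.mem_Ico.1 hj).2
    have hs2 : ∀ i ∈ Finset.range n, Integrable (fun ω => A i ω ^ 2 +
        2 * ∑ j ∈ Finset.Ico (i + 1) n, A i ω * A j ω) P := fun i hi =>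
      (hint2 i (Finset.mem_range.1 hi)).add (hs i hi)
    rw [integral_finsetSum _ hs2]
    refine Finset.sum_congr rfl fun i hi => ?_
    rw [integral_add (hint2 i (Finset.mem_range.1 hi)) (hs i hi), integral_const_mul,
      integral_finsetSum _ fun j hj =>
        hintm i (Finset.mem_range.1 hi) j (Finset.mem_Ico.1 hj).2]
  have t0 : ∑ j ∈ Finset.range n, ∫ ω, A j ω ∂P ≤ D * (1 + T) * ε := by
    have := tail 0 (Nat.zero_le _) (fun _ => 1) measurable_const (fun _ => zero_le_one)
      (fun _ => by nlinarith [sq_nonneg ε])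
    simpa [← Finset.range_eq_Ico] using this
  have t1 : ∀ i ∈ Finset.range n, ((∫ ω, A i ω ^ 2 ∂P) +
        2 * ∑ j ∈ Finset.Ico (i + 1) n, ∫ ω, A i ω * A j ω ∂P) ≤
        ε ^ 4 + 2 * (D * (1 + T) * ε) * ∫ ω, A i ω ∂P := by
    intro i hi
    have hi' := Finset.mem_range.1 hi
    have a1 : ∫ ω, A i ω ^ 2 ∂P ≤ ε ^ 4 := by
      have : ∫ ω, A i ω ^ 2 ∂P ≤ ∫ ω, ε ^ 4 ∂P := by
        refine integral_mono (hint2 i hi') (integrable_const _) fun ω => ?_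
        have := pow_le_pow_left₀ (hA0 i ω) (hA1 i ω) 2
        calc _ ≤ (ε ^ 2) ^ 2 := this
          _ = _ := by ring
      simpa using this
    have a2 := tail (i + 1) hi' (A i) (hA i hi') (hA0 i) fun ω => by linarith [hA1 i ω]
    linarith
  rw [hE]
  calc _ ≤ ∑ i ∈ Finset.range n, (ε ^ 4 + 2 * (D * (1 + T) * ε) * ∫ ω, A i ω ∂P) :=
        Finset.sum_le_sum t1
    _ = n * ε ^ 4 + 2 * (D * (1 + T) * ε) * ∑ i ∈ Finset.range n, ∫ ω, A i ω ∂P := by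
        rw [Finset.sum_add_distrib, ← Finset.mul_sum]; simp
    _ ≤ n * ε ^ 4 + 2 * (D * (1 + T) * ε) * (D * (1 + T) * ε) := by gcongr
    _ = (n * ε ^ 2 + 2 * (D * (1 + T)) ^ 2) * ε ^ 2 := by ring
    _ = _ := by rw [hT]

lemma block_step {Ω : Type*} {G : MeasurableSpace Ω} {m0 : MeasurableSpace Ω} {P : Measure Ω}
    [IsProbabilityMeasure P] (hG : G ≤ m0) {W N : ℝ → Ω → ℝ} {Wr Nr : ℝ × Ω → ℝ}
    (hWr : Measurable Wr) (hNr : Measurable Nr)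
    {a ε L C ζ : ℝ} (hε : 0 < ε) (hC : 0 < C)
    (hWm : ∀ s ∈ Set.Ico a (a + ε ^ 2), Measurable (W s))
    (hNm : ∀ s ∈ Set.Ico a (a + ε ^ 2), Measurable (N s))
    (hreg : ∀ᵐ ω ∂P, ∀ s ∈ Set.Ico a (a + ε ^ 2), Wr (s, ω) = W s ω ∧ Nr (s, ω) = N s ω)
    (hind : ∀ s ∈ Set.Ico a (a + ε ^ 2), Indep (MeasurableSpace.comap
      (fun ω => (W s ω - W a ω, N s ω - N a ω)) inferInstance) G P)
    (hlaw : ∀ s ∈ Set.Ico a (a + ε ^ 2),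
      P.map (fun ω => W s ω - W a ω) = gaussianReal 0 (Real.toNNReal (s - a)))
    (hp : ∀ s ∈ Set.Ico a (a + ε ^ 2), P.real {ω | N s ω - N a ω ≠ 0} ≤ L * ε ^ 2)
    {μ σ ρ : ℝ → ℝ} (hμ : Measurable μ) (hσ : Measurable σ) (hρ : Measurable ρ)
    {H : ℝ → ℝ} {Hb : ℝ} (hH : Measurable H) (hH0 : ∀ x, 0 ≤ H x)
    (hHb : ∀ x, H x ≤ Hb)
    (hkey : ∀ x θ w, 0 ≤ θ → θ ≤ ε ^ 2 → (x - ζ) * (x + μ x * θ + σ x * w - ζ) ≤ 0 →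
          1 ≤ C * ε * H x * (1 + w ^ 4 / ε ^ 4) + C * (ε ^ 2 + w ^ 2))
    {B Y : Ω → ℝ} (hB : Measurable[G] B) (hY : Measurable[G] Y) {b : ℝ} (hB0 : ∀ ω, 0 ≤ B ω)
    (hBb : ∀ ω, B ω ≤ b) :
    ∫ ω, B ω * (∫ s in Set.Ico a (a + ε ^ 2), if (Y ω - ζ) * (Y ω + μ (Y ω) * (s - a) +
        σ (Y ω) * (Wr (s, ω) - W a ω) + ρ (Y ω) * (Nr (s, ω) - N a ω) - ζ) ≤ 0
        then (1 : ℝ) else 0) ∂P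
      ≤ ε ^ 2 * (C * ε * (1 + gM) * (∫ ω, B ω * H (Y ω) ∂P) +
        (2 * C + L) * ε ^ 2 * ∫ ω, B ω ∂P) := by
  have hB' : Measurable B := hB.mono hG le_rfl
  have hY' : Measurable Y := hY.mono hG le_rfl
  have hε2 : 0 < ε ^ 2 := by positivity
  have ha : a ∈ Set.Ico a (a + ε ^ 2) := ⟨le_rfl, by linarith⟩
  have hWa := hWm a ha
  have hNa := hNm a ha
  have hBabs : ∀ ω, |B ω| ≤ b := fun ω => by rw [abs_of_nonneg (hB0 ω)]; exact hBb ω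
  set Q : Ω → ℝ → ℝ := fun ω s => B ω * (if (Y ω - ζ) * (Y ω + μ (Y ω) * (s - a) +
        σ (Y ω) * (Wr (s, ω) - W a ω) + ρ (Y ω) * (Nr (s, ω) - N a ω) - ζ) ≤ 0
        then (1 : ℝ) else 0) with hQ
  have hQm : Measurable (Function.uncurry Q) := by
    have hWr' : Measurable (fun p : Ω × ℝ => Wr (p.2, p.1)) := hWr.comp measurable_swap
    have hNr' : Measurable (fun p : Ω × ℝ => Nr (p.2, p.1)) := hNr.comp measurable_swap
    refine Measurable.mul (by fun_prop)
      (Measurable.ite (measurableSet_le ?_ measurable_const) measurable_const measurable_const)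
    have h1 : Measurable (fun p : Ω × ℝ => Y p.1) := by fun_prop
    have h2 : Measurable (fun p : Ω × ℝ => W a p.1) := by fun_prop
    have h3 : Measurable (fun p : Ω × ℝ => N a p.1) := by fun_prop
    fun_prop
  have hQi : Integrable (Function.uncurry Q)
      (P.prod (volume.restrict (Set.Ico a (a + ε ^ 2)))) := by
    refine Integrable.of_bound hQm.aestronglyMeasurable b ?_
    filter_upwards with p
    simp only [Function.uncurry, hQ, Real.norm_eq_abs]
    split_ifs
    · simpa using hBabs p.1
    · simpa using (hB0 p.1).trans (hBb p.1)
  have e1 : ∫ ω, B ω * (∫ s in Set.Ico a (a + ε ^ 2), if (Y ω - ζ) * (Y ω + μ (Y ω) * (s - a) +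
        σ (Y ω) * (Wr (s, ω) - W a ω) + ρ (Y ω) * (Nr (s, ω) - N a ω) - ζ) ≤ 0
        then (1 : ℝ) else 0) ∂P = ∫ s in Set.Ico a (a + ε ^ 2), ∫ ω, Q ω s ∂P := by
    rw [← integral_integral_swap hQi]
    refine integral_congr_ae ?_
    filter_upwards with ω
    rw [← integral_const_mul]
  rw [e1]
  have hQi2 : IntegrableOn (fun s => ∫ ω, Q ω s ∂P) (Set.Ico a (a + ε ^ 2)) :=
    hQi.integral_prod_right
  set R := C * ε * (1 + gM) * (∫ ω, B ω * H (Y ω) ∂P) + (2 * C + L) * ε ^ 2 * ∫ ω, B ω ∂P with hR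
  have hle : ∀ s ∈ Set.Ico a (a + ε ^ 2), ∫ ω, Q ω s ∂P ≤ R := by
    intro s hs
    have hc := step_cross (P := P) hG ((hWm s hs).sub hWa) ((hNm s hs).sub hNa) (hind s hs) hε hC
      (sub_nonneg.2 hs.1) (by linarith [hs.2]) (hlaw s hs) (hp s hs) hμ hσ hρ hH hH0 hHb hkey
      hB hY hB0 hBb
    refine le_trans (le_of_eq ?_) hc
    refine integral_congr_ae ?_
    filter_upwards [hreg] with ω hω
    simp only [hQ, (hω s hs).1, (hω s hs).2]
    rfl
  calc ∫ s in Set.Ico a (a + ε ^ 2), ∫ ω, Q ω s ∂P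
      ≤ ∫ s in Set.Ico a (a + ε ^ 2), R :=
        setIntegral_mono_on hQi2 (integrable_const _) measurableSet_Ico hle
    _ = ε ^ 2 * R := by
        rw [setIntegral_const, Measure.real, Real.volume_Ico, add_sub_cancel_left,
          ENNReal.toReal_ofReal hε2.le, smul_eq_mul]

lemma block_meas {Ω : Type*} {G : MeasurableSpace Ω} {Wr Nr : ℝ × Ω → ℝ}
    (hWr : Measurable Wr) (hNr : Measurable Nr) {Wa Na Y : Ω → ℝ} (hWa : Measurable Wa)
    (hNa : Measurable Na) (hY : Measurable Y) {μ σ ρ : ℝ → ℝ} (hμ : Measurable μ)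
    (hσ : Measurable σ) (hρ : Measurable ρ) (a c ζ : ℝ) :
    Measurable (fun p : Ω × ℝ => if (Y p.1 - ζ) * (Y p.1 + μ (Y p.1) * (p.2 - a) +
        σ (Y p.1) * (Wr (p.2, p.1) - Wa p.1) + ρ (Y p.1) * (Nr (p.2, p.1) - Na p.1) - ζ) ≤ 0
        then (1 : ℝ) else 0) ∧
    Measurable (fun ω => ∫ s in Set.Ico a c, if (Y ω - ζ) * (Y ω + μ (Y ω) * (s - a) +
        σ (Y ω) * (Wr (s, ω) - Wa ω) + ρ (Y ω) * (Nr (s, ω) - Na ω) - ζ) ≤ 0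
        then (1 : ℝ) else 0) := by
  have hWr' : Measurable (fun p : Ω × ℝ => Wr (p.2, p.1)) := hWr.comp measurable_swap
  have hNr' : Measurable (fun p : Ω × ℝ => Nr (p.2, p.1)) := hNr.comp measurable_swap
  have hm : Measurable (fun p : Ω × ℝ => if (Y p.1 - ζ) * (Y p.1 + μ (Y p.1) * (p.2 - a) +
        σ (Y p.1) * (Wr (p.2, p.1) - Wa p.1) + ρ (Y p.1) * (Nr (p.2, p.1) - Na p.1) - ζ) ≤ 0
        then (1 : ℝ) else 0) := by
    refine Measurable.ite (measurableSet_le ?_ measurable_const) measurable_const measurable_const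
    fun_prop
  refine ⟨hm, ?_⟩
  exact (hm.stronglyMeasurable.integral_prod_right' (ν := volume.restrict (Set.Ico a c))).measurable

lemma block_bounds (q : ℝ → Prop) [DecidablePred q] (a c : ℝ) (hc : 0 ≤ c) :
    0 ≤ (∫ s in Set.Ico a (a + c), if q s then (1 : ℝ) else 0) ∧
    (∫ s in Set.Ico a (a + c), if q s then (1 : ℝ) else 0) ≤ c := by
  constructor
  · refine integral_nonneg fun s => ?_
    dsimp only
    split_ifs <;> norm_num
  · have h := norm_setIntegral_le_of_norm_le_const (μ := volume) (s := Set.Ico a (a + c)) (C := 1)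
      (f := fun s => if q s then (1 : ℝ) else 0) (by simp) (fun s _ => by split_ifs <;> norm_num)
    refine (le_abs_self _).trans (h.trans (le_of_eq ?_))
    simp [Measure.real, hc]

lemma lint_blocks (g : ℝ → ENNReal) (A : ℕ → ℝ) (hA : ∀ j, 0 ≤ A j) (δ : ℝ) (hδ : 0 ≤ δ) (n : ℕ)
    (h : ∀ j < n, ∫⁻ s in Set.Ico ((j : ℝ) * δ) (j * δ + δ), g s = ENNReal.ofReal (A j)) :
    ∫⁻ s in Set.Icc 0 ((n : ℝ) * δ), g s = ENNReal.ofReal (∑ j ∈ Finset.range n, A j) := by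
  rw [setLIntegral_congr Ico_ae_eq_Icc.symm]
  have : ∀ k ≤ n, ∫⁻ s in Set.Ico 0 ((k : ℝ) * δ), g s =
      ENNReal.ofReal (∑ j ∈ Finset.range k, A j) := by
    intro k
    induction k with
    | zero => intro _; simp
    | succ k ih =>
      intro hk
      have hu : Set.Ico 0 (((k + 1 : ℕ) : ℝ) * δ) =
          Set.Ico 0 ((k : ℝ) * δ) ∪ Set.Ico ((k : ℝ) * δ) (k * δ + δ) := by
        rw [Set.Ico_union_Ico_eq_Ico (by positivity) (by linarith)]
        push_cast
        congr 1
        ring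
      rw [hu, lintegral_union measurableSet_Ico (Set.Ico_disjoint_Ico_same), ih (by omega),
        h k (by omega), Finset.sum_range_succ, ENNReal.ofReal_add (Finset.sum_nonneg fun j _ => hA j)
        (hA k)]
  exact this n le_rfl

lemma floor_block {δ : ℝ} (hδ : 0 < δ) (j : ℕ) {s : ℝ}
    (hs : s ∈ Set.Ico ((j : ℝ) * δ) (j * δ + δ)) : ⌊s / δ⌋.toNat = j := by
  have : ⌊s / δ⌋ = (j : ℤ) := by
    rw [Int.floor_eq_iff]
    constructor
    · rw [le_div_iff₀ hδ]; exact_mod_cast hs.1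
    · rw [div_lt_iff₀ hδ]
      have := hs.2
      push_cast
      linarith
  rw [this]; rfl

lemma lastGrid_block {δ : ℝ} (hδ : 0 < δ) (j : ℕ) {s : ℝ}
    (hs : s ∈ Set.Ico ((j : ℝ) * δ) (j * δ + δ)) : lastGrid δ s = j * δ := by
  rw [lastGrid, floor_block hδ j hs]

lemma emProc_block {Ω : Type*} (μ σ ρ : ℝ → ℝ) (W N : ℝ → Ω → ℝ) {δ : ℝ} (hδ : 0 < δ) (x : ℝ)
    (j : ℕ) {s : ℝ} (hs : s ∈ Set.Ico ((j : ℝ) * δ) (j * δ + δ)) (ω : Ω) :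
    emProc μ σ ρ W N δ x s ω = emGrid μ σ ρ W N δ x j ω
    + μ (emGrid μ σ ρ W N δ x j ω) * (s - j * δ)
    + σ (emGrid μ σ ρ W N δ x j ω) * (W s ω - W (j * δ) ω)
    + ρ (emGrid μ σ ρ W N δ x j ω) * (N s ω - N (j * δ) ω) := by
  rw [emProc, lastGrid_block hδ j hs, floor_block hδ j hs]

lemma emProc_grid {Ω : Type*} (μ σ ρ : ℝ → ℝ) (W N : ℝ → Ω → ℝ) {δ : ℝ} (hδ : 0 < δ) (x : ℝ)
    (j : ℕ) {s : ℝ} (hs : s ∈ Set.Ico ((j : ℝ) * δ) (j * δ + δ)) (ω : Ω) :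
    emProc μ σ ρ W N δ x (lastGrid δ s) ω = emGrid μ σ ρ W N δ x j ω := by
  rw [lastGrid_block hδ j hs, emProc_block μ σ ρ W N hδ x j ⟨le_rfl, by linarith⟩ ω]
  simp

lemma emGrid_measurable {Ω : Type*} {m0 : MeasurableSpace Ω} (F : Filtration ℝ m0) {T : ℝ}
    {W N : ℝ → Ω → ℝ}
    (hW : ∀ t ∈ Set.Icc (0:ℝ) T, Measurable[F t] (W t))
    (hN : ∀ t ∈ Set.Icc (0:ℝ) T, Measurable[F t] (N t))
    {μ σ ρ : ℝ → ℝ} (hμ : Measurable μ) (hσ : Measurable σ) (hρ : Measurable ρ) {δ : ℝ}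
    (hδ : 0 < δ) (x : ℝ) (n : ℕ) (hn : (n : ℝ) * δ = T) :
    ∀ j ≤ n, Measurable[F ((j : ℝ) * δ)] (emGrid μ σ ρ W N δ x j) := by
  intro j
  induction j with
  | zero => intro _; exact measurable_const
  | succ j ih =>
    intro hj
    have hle : (j : ℝ) * δ ≤ ((j : ℝ) + 1) * δ := by nlinarith
    have h1 : ((j : ℝ) + 1) * δ ≤ T := by
      rw [← hn]
      gcongr
      exact_mod_cast hj
    have h0 : 0 ≤ (j : ℝ) * δ := by positivity
    have hF := F.mono hle
    have m1 : Measurable[F (((j : ℝ) + 1) * δ)] (emGrid μ σ ρ W N δ x j) :=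
      (ih (by omega)).mono hF le_rfl
    have m2 := hW _ ⟨h0.trans hle, h1⟩
    have m3 := hN _ ⟨h0.trans hle, h1⟩
    have m4 := (hW _ ⟨h0, hle.trans h1⟩).mono hF le_rfl
    have m5 := (hN _ ⟨h0, hle.trans h1⟩).mono hF le_rfl
    have e : (((j + 1 : ℕ) : ℝ)) * δ = ((j : ℝ) + 1) * δ := by push_cast; rfl
    rw [e]
    have m6 : Measurable[F (((j : ℝ) + 1) * δ)] (fun _ : Ω => δ) := measurable_const
    exact ((m1.add ((hμ.comp m1).mul m6)).add ((hσ.comp m1).mul (m2.sub m4))).add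
      ((hρ.comp m1).mul (m3.sub m5))

lemma em_single {Ω : Type*} {m0 : MeasurableSpace Ω}
    (F : Filtration ℝ m0) (P : Measure Ω) [IsProbabilityMeasure P]
    (T : ℝ) (W N : ℝ → Ω → ℝ)
    (hW_adapted : ∀ t ∈ Set.Icc (0:ℝ) T, Measurable[F t] (W t))
    (hN_adapted : ∀ t ∈ Set.Icc (0:ℝ) T, Measurable[F t] (N t))
    (hW_cont : ∀ᵐ ω ∂P, ContinuousOn (fun t => W t ω) (Set.Icc 0 T))
    (hN_rc : ∀ᵐ ω ∂P, ∀ t ∈ Set.Ico (0:ℝ) T,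
      Filter.Tendsto (fun u => N u ω) (nhdsWithin t (Set.Ioi t)) (nhds (N t ω)))
    (hW_gauss : ∀ s t : ℝ, 0 ≤ s → s ≤ t → t ≤ T →
      Measure.map (fun ω => W t ω - W s ω) P = gaussianReal 0 (Real.toNNReal (t - s)))
    (L : ℝ) (hL : 0 < L)
    (hjump : ∀ s t : ℝ, 0 ≤ s → s ≤ t → t ≤ T → P.real {ω | N t ω - N s ω ≠ 0} ≤ L * (t - s))
    (h_indep : ∀ s t : ℝ, 0 ≤ s → s ≤ t → t ≤ T →
      Indep (MeasurableSpace.comap (fun ω => (W t ω - W s ω, N t ω - N s ω)) inferInstance)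
        (F s) P)
    (μ σ ρ : ℝ → ℝ) (hμ : Measurable μ) (hσ : Measurable σ) (hρ : Measurable ρ)
    (ξ ζ C ε : ℝ) (hC : 0 < C) (hε : 0 < ε) (hε1 : ε ≤ 1) (H f : ℝ → ℝ) (Hb : ℝ)
    (hH : Measurable H) (hf : Measurable f) (hH0 : ∀ x, 0 ≤ H x)
    (hHb : ∀ x, H x ≤ Hb) (hf0 : ∀ x, 0 ≤ f x) (hf1 : ∀ x, f x ≤ 1)
    (hkey1 : ∀ x w, H x * (w ^ 2 - w ^ 4 / (2 * gM * ε ^ 2)) - C * w ^ 2 - C * ε ^ 2 ≤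
          f (x + μ x * ε ^ 2 + σ x * w) + f (x + μ x * ε ^ 2 - σ x * w) - 2 * f x)
    (hkey2 : ∀ x θ w, 0 ≤ θ → θ ≤ ε ^ 2 → (x - ζ) * (x + μ x * θ + σ x * w - ζ) ≤ 0 →
          1 ≤ C * ε * H x * (1 + w ^ 4 / ε ^ 4) + C * (ε ^ 2 + w ^ 2))
    (n : ℕ) (hn : (n : ℝ) * ε ^ 2 = T) :
    ∫⁻ ω, (∫⁻ s in Set.Icc (0:ℝ) T,
          if (emProc μ σ ρ W N (ε ^ 2) ξ (lastGrid (ε ^ 2) s) ω - ζ)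
              * (emProc μ σ ρ W N (ε ^ 2) ξ s ω - ζ) ≤ 0
            then (1 : ENNReal) else 0) ^ 2 ∂P
        ≤ ENNReal.ofReal ((T + 2 * ((4 * C * (1 + gM) * (1 + C + L) + 2 * C + L) * (1 + T)) ^ 2)
          * ε ^ 2) := by
  have hgM := gM_ge_one
  have hδ : 0 < ε ^ 2 := by positivity
  set δ := ε ^ 2 with hδdef
  have hend : ∀ j < n, (j : ℝ) * δ + δ ≤ T := by
    intro j hj
    have : ((j : ℝ) + 1) * δ ≤ n * δ := by
      gcongr
      exact_mod_cast hj
    linarith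
  have hst : ∀ j : ℕ, 0 ≤ (j : ℝ) * δ := fun j => by positivity
  -- regular versions
  have hex : ∀ j : ℕ, ∃ V : (ℝ × Ω → ℝ) × (ℝ × Ω → ℝ), j < n →
      (@Measurable _ _ (@Prod.instMeasurableSpace ℝ Ω _ (F ((j : ℝ) * δ + δ))) _ V.1 ∧
       @Measurable _ _ (@Prod.instMeasurableSpace ℝ Ω _ (F ((j : ℝ) * δ + δ))) _ V.2 ∧
       ∀ᵐ ω ∂P, ∀ s ∈ Set.Ico ((j : ℝ) * δ) (j * δ + δ), V.1 (s, ω) = W s ω ∧ V.2 (s, ω) = N s ω) := by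
    intro j
    by_cases hj : j < n
    · have hsub : ∀ t ∈ Set.Icc ((j : ℝ) * δ) (j * δ + δ), t ∈ Set.Icc 0 T := fun t ht =>
        ⟨(hst j).trans ht.1, ht.2.trans (hend j hj)⟩
      obtain ⟨V1, hV1, hV1'⟩ := @exists_regular Ω (F ((j : ℝ) * δ + δ)) W ((j : ℝ) * δ)
        (j * δ + δ) (by linarith) fun t ht => (hW_adapted t (hsub t ht)).mono (F.mono ht.2) le_rfl
      obtain ⟨V2, hV2, hV2'⟩ := @exists_regular Ω (F ((j : ℝ) * δ + δ)) N ((j : ℝ) * δ)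
        (j * δ + δ) (by linarith) fun t ht => (hN_adapted t (hsub t ht)).mono (F.mono ht.2) le_rfl
      refine ⟨(V1, V2), fun _ => ⟨hV1, hV2, ?_⟩⟩
      filter_upwards [hW_cont, hN_rc] with ω hw hr s hs
      refine ⟨hV1' ω ?_ s hs, hV2' ω ?_ s hs⟩
      · intro t ht
        have ht0 : t ∈ Set.Icc 0 T := hsub t ⟨ht.1, ht.2.le⟩
        have htT : t < T := ht.2.trans_le (hend j hj)
        have hc := hw t ht0
        refine hc.mono_left ?_
        rw [← nhdsWithin_Ioo_eq_nhdsGT htT]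
        exact nhdsWithin_mono _ fun u hu => ⟨ht0.1.trans hu.1.le, hu.2.le⟩
      · intro t ht
        exact hr t ⟨(hst j).trans ht.1, ht.2.trans_le (hend j hj)⟩
    · exact ⟨(fun _ => 0, fun _ => 0), fun h => absurd h hj⟩
  choose V hV using hex
  let Y : ℕ → Ω → ℝ := fun j => emGrid μ σ ρ W N δ ξ j
  have hY : ∀ j ≤ n, Measurable[F ((j : ℝ) * δ)] (Y j) :=
    emGrid_measurable F hW_adapted hN_adapted hμ hσ hρ hδ ξ n hn
  let A : ℕ → Ω → ℝ := fun j ω => ∫ s in Set.Ico ((j : ℝ) * δ) (j * δ + δ),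
    if (Y j ω - ζ) * (Y j ω + μ (Y j ω) * (s - j * δ) +
        σ (Y j ω) * ((V j).1 (s, ω) - W (j * δ) ω) +
        ρ (Y j ω) * ((V j).2 (s, ω) - N (j * δ) ω) - ζ) ≤ 0
        then (1 : ℝ) else 0
  have hA01 : ∀ j ω, 0 ≤ A j ω ∧ A j ω ≤ δ := fun j ω => block_bounds _ _ _ hδ.le
  have hmeas : ∀ j < n, Measurable[F ((j : ℝ) * δ + δ)] (A j) ∧ ∀ ω, Measurable (fun s : ℝ =>
    if (Y j ω - ζ) * (Y j ω + μ (Y j ω) * (s - j * δ) +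
        σ (Y j ω) * ((V j).1 (s, ω) - W (j * δ) ω) +
        ρ (Y j ω) * ((V j).2 (s, ω) - N (j * δ) ω) - ζ) ≤ 0
        then (1 : ℝ) else 0) := by
    intro j hj
    have hF : F ((j : ℝ) * δ) ≤ F ((j : ℝ) * δ + δ) := F.mono (by linarith)
    have hm : (j : ℝ) * δ ∈ Set.Icc 0 T := ⟨hst j, by linarith [hend j hj]⟩
    have h := @block_meas Ω (F ((j : ℝ) * δ + δ)) _ _ (hV j hj).1 (hV j hj).2.1 _ _ _
      ((hW_adapted _ hm).mono hF le_rfl) ((hN_adapted _ hm).mono hF le_rfl)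
      ((hY j hj.le).mono hF le_rfl) _ _ _ hμ hσ hρ (j * δ) (j * δ + δ) ζ
    refine ⟨h.2, fun ω => ?_⟩
    exact h.1.comp (@measurable_prodMk_left Ω ℝ (F ((j : ℝ) * δ + δ)) _ ω)
  -- pathwise identity
  have hpath : ∀ᵐ ω ∂P, (∫⁻ s in Set.Icc (0:ℝ) T,
          if (emProc μ σ ρ W N δ ξ (lastGrid δ s) ω - ζ)
              * (emProc μ σ ρ W N δ ξ s ω - ζ) ≤ 0
            then (1 : ENNReal) else 0) = ENNReal.ofReal (∑ j ∈ Finset.range n, A j ω) := by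
    have hall : ∀ᵐ ω ∂P, ∀ j : ℕ, j < n → ∀ s ∈ Set.Ico ((j : ℝ) * δ) (j * δ + δ),
        (V j).1 (s, ω) = W s ω ∧ (V j).2 (s, ω) = N s ω := by
      rw [ae_all_iff]
      intro j
      by_cases hj : j < n
      · filter_upwards [(hV j hj).2.2] with ω hω _
        exact hω
      · filter_upwards with ω h
        exact absurd h hj
    filter_upwards [hall] with ω hω
    rw [← hn]
    refine lint_blocks _ (fun j => A j ω) (fun j => (hA01 j ω).1) δ hδ.le n fun j hj => ?_
    have hmj := (hmeas j hj).2 ω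
    simp only [A]
    rw [ofReal_integral_eq_lintegral_ofReal]
    · refine setLIntegral_congr_fun measurableSet_Ico fun s hs => ?_
      rw [emProc_grid μ σ ρ W N hδ ξ j hs, emProc_block μ σ ρ W N hδ ξ j hs,
        (hω j hj s hs).1, (hω j hj s hs).2]
      simp only [Y]
      split_ifs <;> simp
    · refine Integrable.of_bound hmj.aestronglyMeasurable 1 ?_
      filter_upwards with s
      split_ifs <;> simp
    · filter_upwards with s
      split_ifs <;> norm_num
  have hmono : Monotone (fun j : ℕ => F ((j : ℝ) * δ)) := by
    intro i j hij
    refine F.mono ?_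
    gcongr
  have hsucc : ∀ j : ℕ, (((j + 1 : ℕ) : ℝ)) * δ = (j : ℝ) * δ + δ := fun j => by push_cast; ring
  have hmain := sum_square (P := P) (fun j : ℕ => F ((j : ℝ) * δ)) (fun j => F.le _) hmono n A
    (fun j ω => f (Y j ω)) (ε := ε) (D := 4 * C * (1 + gM) * (1 + C + L) + 2 * C + L)
    (D1 := 4 * C * (1 + gM)) (T := T) hε (by positivity)
    (by nlinarith [mul_pos (mul_pos hC (by linarith : (0:ℝ) < 1 + gM)) (add_pos hC hL)])
    (by positivity) hn
    (fun j hj => by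
      have h := (hmeas j hj).1
      rw [← hsucc] at h
      exact h)
    (fun j ω => (hA01 j ω).1) (fun j ω => (hA01 j ω).2)
    (fun j hj => hf.comp ((hY j hj).mono (F.le _) le_rfl)) (fun _ _ => hf0 _) (fun _ _ => hf1 _)
    (by
      intro j hj B hB hB0 hB1
      have hm0 : ∀ t, 0 ≤ t → t ≤ T → Measurable (W t) := fun t h0 h1 =>
        (hW_adapted t ⟨h0, h1⟩).mono (F.le _) le_rfl
      have hn0 : ∀ t, 0 ≤ t → t ≤ T → Measurable (N t) := fun t h0 h1 =>
        (hN_adapted t ⟨h0, h1⟩).mono (F.le _) le_rfl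
      have hpm : (@Prod.instMeasurableSpace ℝ Ω _ (F ((j : ℝ) * δ + δ))) ≤
          (@Prod.instMeasurableSpace ℝ Ω _ m0) :=
        sup_le_sup le_rfl (MeasurableSpace.comap_mono (F.le _))
      have hj1 := hend j hj
      have hj0 := hst j
      have hlow := step_lower (P := P) (F.le ((j : ℝ) * δ))
        ((hm0 (j * δ + δ) (by linarith) hj1).sub (hm0 (j * δ) hj0 (by linarith)))
        ((hn0 (j * δ + δ) (by linarith) hj1).sub (hn0 (j * δ) hj0 (by linarith)))
        (h_indep (j * δ) (j * δ + δ) hj0 (by linarith) hj1) (L := L) hε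
        (by
          have := hW_gauss (j * δ) (j * δ + δ) hj0 (by linarith) hj1
          rw [add_sub_cancel_left] at this
          exact this)
        (by
          have := hjump (j * δ) (j * δ + δ) hj0 (by linarith) hj1
          rw [add_sub_cancel_left] at this
          exact this) hμ hσ hρ hH hf hH0 hHb hf0 hf1 hkey1 hB (hY j hj.le) hB0 hB1
      have hblk := block_step (P := P) (F.le ((j : ℝ) * δ)) (W := W) (N := N)
        ((hV j hj).1.mono hpm le_rfl) ((hV j hj).2.1.mono hpm le_rfl) (a := (j : ℝ) * δ)
        (L := L) (ζ := ζ) hε hC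
        (fun s hs => hm0 s (hj0.trans hs.1) (hs.2.le.trans hj1))
        (fun s hs => hn0 s (hj0.trans hs.1) (hs.2.le.trans hj1))
        (hV j hj).2.2
        (fun s hs => h_indep _ s hj0 hs.1 (hs.2.le.trans hj1))
        (fun s hs => hW_gauss _ s hj0 hs.1 (hs.2.le.trans hj1))
        (fun s hs => (hjump _ s hj0 hs.1 (hs.2.le.trans hj1)).trans (by
          have := hs.2
          gcongr
          linarith)) hμ hσ hρ hH hH0 hHb hkey2 hB (hY j hj.le) hB0 hB1
      have hYs : ∀ ω, Y (j + 1) ω = Y j ω + μ (Y j ω) * ε ^ 2 +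
          σ (Y j ω) * (W (j * δ + δ) - W (j * δ)) ω + ρ (Y j ω) * (N (j * δ + δ) - N (j * δ)) ω := by
        intro ω
        have e : ((j : ℝ) + 1) * δ = j * δ + δ := by ring
        simp only [Y, emGrid, Pi.sub_apply, e]
        rfl
      simp_rw [← hYs] at hlow
      have hIB : 0 ≤ ∫ ω, B ω ∂P := integral_nonneg hB0
      refine hblk.trans ?_
      have hc0 : 0 ≤ 4 * C * (1 + gM) * ε := by positivity
      have h1 := mul_le_mul_of_nonneg_left hlow hc0
      have h2 : ε ^ 3 * ε * ((2 * C + L) * ∫ ω, B ω ∂P) ≤ ε ^ 3 * 1 * ((2 * C + L) * ∫ ω, B ω ∂P) := by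
        gcongr
      have h3 : 0 ≤ 4 * C * (1 + gM) * ε ^ 3 * ∫ ω, B ω ∂P := by positivity
      linarith)
  have hsm : Measurable (fun ω => ∑ j ∈ Finset.range n, A j ω) :=
    Finset.measurable_sum _ fun j hj =>
      ((hmeas j (Finset.mem_range.1 hj)).1).mono (F.le _) le_rfl
  have hs0 : ∀ ω, 0 ≤ ∑ j ∈ Finset.range n, A j ω := fun ω =>
    Finset.sum_nonneg fun j _ => (hA01 j ω).1
  have hsb : ∀ ω, ∑ j ∈ Finset.range n, A j ω ≤ T := fun ω => by
    calc _ ≤ ∑ j ∈ Finset.range n, δ := Finset.sum_le_sum fun j _ => (hA01 j ω).2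
      _ = T := by rw [Finset.sum_const, Finset.card_range, nsmul_eq_mul, hn]
  have hIntS : Integrable (fun ω => (∑ j ∈ Finset.range n, A j ω) ^ 2) P := by
    refine bdd_integrable (hsm.pow_const 2) (b := T ^ 2) fun ω => ?_
    rw [abs_of_nonneg (sq_nonneg _)]
    exact pow_le_pow_left₀ (hs0 ω) (hsb ω) 2
  calc _ = ∫⁻ ω, ENNReal.ofReal ((∑ j ∈ Finset.range n, A j ω) ^ 2) ∂P := by
        refine lintegral_congr_ae ?_
        filter_upwards [hpath] with ω hω
        rw [hω, ENNReal.ofReal_pow (hs0 ω)]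
    _ = ENNReal.ofReal (∫ ω, (∑ j ∈ Finset.range n, A j ω) ^ 2 ∂P) := by
        rw [ofReal_integral_eq_lintegral_ofReal hIntS]
        filter_upwards with ω
        exact sq_nonneg _
    _ ≤ _ := ENNReal.ofReal_le_ofReal hmain

/-- Estimate of the discontinuity crossing probability:
`E[(∫_0^T 1_{(X^{(δ)}_{s̲} - ζ_k)(X^{(δ)}_s - ζ_k) ≤ 0} ds)²] ≤ C δ`. -/
theorem em_discontinuity_crossing_estimate
    {Ω : Type*} {m0 : MeasurableSpace Ω}
    (F : Filtration ℝ m0) (P : Measure Ω) [IsProbabilityMeasure P]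
    (T : ℝ) (hT : 0 < T)
    (lam : ℝ → ℝ) (hlam_meas : Measurable lam)
    (hlam_pos : ∀ t ∈ Set.Icc (0:ℝ) T, 0 < lam t)
    (lamB : ℝ) (hlamB : ∀ t ∈ Set.Icc (0:ℝ) T, lam t ≤ lamB)
    (W N : ℝ → Ω → ℝ)
    (hW0 : ∀ ω, W 0 ω = 0) (hN0 : ∀ ω, N 0 ω = 0)
    (hW_adapted : ∀ t ∈ Set.Icc (0:ℝ) T, Measurable[F t] (W t))
    (hN_adapted : ∀ t ∈ Set.Icc (0:ℝ) T, Measurable[F t] (N t))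
    (hW_cont : ∀ᵐ ω ∂P, ContinuousOn (fun t => W t ω) (Set.Icc 0 T))
    (hN_mono : ∀ᵐ ω ∂P, ∀ s t : ℝ, 0 ≤ s → s ≤ t → t ≤ T → N s ω ≤ N t ω)
    (hN_rc : ∀ᵐ ω ∂P, ∀ t ∈ Set.Ico (0:ℝ) T,
      Filter.Tendsto (fun u => N u ω) (nhdsWithin t (Set.Ioi t)) (nhds (N t ω)))
    (hN_int : ∀ᵐ ω ∂P, ∀ t ∈ Set.Icc (0:ℝ) T, ∃ k : ℕ, N t ω = k)
    (hW_gauss : ∀ s t : ℝ, 0 ≤ s → s ≤ t → t ≤ T →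
      Measure.map (fun ω => W t ω - W s ω) P = gaussianReal 0 (Real.toNNReal (t - s)))
    (hN_poisson : ∀ s t : ℝ, 0 ≤ s → s ≤ t → t ≤ T →
      Measure.map (fun ω => N t ω - N s ω) P
        = Measure.map (fun k : ℕ => (k : ℝ))
            (poissonMeasure (Real.toNNReal (∫ u in s..t, lam u))))
    (h_indep : ∀ s t : ℝ, 0 ≤ s → s ≤ t → t ≤ T →
      Indep (MeasurableSpace.comap (fun ω => (W t ω - W s ω, N t ω - N s ω)) inferInstance)
        (F s) P)
    (hWN_indep : ∀ s t : ℝ, 0 ≤ s → s ≤ t → t ≤ T →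
      IndepFun (fun ω => W t ω - W s ω) (fun ω => N t ω - N s ω) P)
    (μ σ ρ : ℝ → ℝ) (hμ_meas : Measurable μ) (hσ_meas : Measurable σ) (hρ_meas : Measurable ρ)
    (m : ℕ) (hm : 0 < m) (ζ : Fin m → ℝ) (hζ : StrictMono ζ)
    (hμ_low : ∃ K : NNReal, LipschitzOnWith K μ (Set.Iio (ζ ⟨0, hm⟩)))
    (hμ_high : ∃ K : NNReal, LipschitzOnWith K μ (Set.Ioi (ζ ⟨m - 1, Nat.sub_lt hm one_pos⟩)))
    (hμ_mid : ∀ (k : Fin m) (h : (k : ℕ) + 1 < m),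
      ∃ K : NNReal, LipschitzOnWith K μ (Set.Ioo (ζ k) (ζ ⟨(k : ℕ) + 1, h⟩)))
    (hσ_lip : ∃ K : NNReal, LipschitzWith K σ)
    (hσ_nz : ∀ k : Fin m, σ (ζ k) ≠ 0)
    (hρ_lip : ∃ K : NNReal, LipschitzWith K ρ)
    (ξ : ℝ) :
    ∃ C : ℝ, 0 < C ∧ ∃ δ0 : ℝ, δ0 ∈ Set.Ioo (0:ℝ) 1 ∧ ∀ n : ℕ, 0 < n → T / n < δ0 →
      ∀ k : Fin m,
      ∫⁻ ω, (∫⁻ s in Set.Icc (0:ℝ) T,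
          if (emProc μ σ ρ W N (T / n) ξ (lastGrid (T / n) s) ω - ζ k)
              * (emProc μ σ ρ W N (T / n) ξ s ω - ζ k) ≤ 0
            then (1 : ENNReal) else 0) ^ 2 ∂P
        ≤ ENNReal.ofReal (C * (T / n)) := by
  have hlamB0 : 0 < lamB :=
    (hlam_pos 0 ⟨le_rfl, hT.le⟩).trans_le (hlamB 0 ⟨le_rfl, hT.le⟩)
  have hjump : ∀ s t : ℝ, 0 ≤ s → s ≤ t → t ≤ T →
      P.real {ω | N t ω - N s ω ≠ 0} ≤ lamB * (t - s) := by
    intro s t h0 hst ht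
    have hm : Measurable (fun ω => N t ω - N s ω) :=
      ((hN_adapted t ⟨h0.trans hst, ht⟩).mono (F.le _) le_rfl).sub
        ((hN_adapted s ⟨h0, hst.trans ht⟩).mono (F.le _) le_rfl)
    refine (poisson_jump hm (hN_poisson s t h0 hst ht)).trans ?_
    have hb : ‖∫ u in s..t, lam u‖ ≤ lamB * |t - s| := by
      refine intervalIntegral.norm_integral_le_of_norm_le_const fun u hu => ?_
      rw [Set.uIoc_of_le hst] at hu
      have hu' : u ∈ Set.Icc 0 T := ⟨h0.trans hu.1.le, hu.2.trans ht⟩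
      rw [Real.norm_eq_abs, abs_of_pos (hlam_pos u hu')]
      exact hlamB u hu'
    rw [abs_of_nonneg (sub_nonneg.2 hst)] at hb
    rw [Real.coe_toNNReal']
    exact max_le ((le_abs_self _).trans hb) (mul_nonneg hlamB0.le (sub_nonneg.2 hst))
  obtain ⟨Aμ, hAμ0, hAμ⟩ := piecewise_growth μ m hm ζ hμ_low hμ_high hμ_mid
  obtain ⟨Kσ, hKσ⟩ := hσ_lip
  obtain ⟨Aσ, hAσ⟩ := lip_growth σ Kσ Set.univ (hKσ.lipschitzOnWith)
  have hconv : ∀ A z x : ℝ, ∀ g : ℝ, |g| ≤ A * (1 + |x|) →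
      |g| ≤ max 1 (max Aμ Aσ * (1 + |z|)) * (1 + |x - z|) ∨ ¬ (A ≤ max Aμ Aσ) := by
    intro A z x g hg
    by_cases hA : A ≤ max Aμ Aσ
    · left
      have hM : 0 ≤ max Aμ Aσ := hAμ0.trans (le_max_left _ _)
      have h1 : 1 + |x| ≤ (1 + |z|) * (1 + |x - z|) := by
        have e : |x| ≤ |x - z| + |z| := by
          calc |x| = |(x - z) + z| := by ring_nf
            _ ≤ _ := abs_add_le _ _
        nlinarith [mul_nonneg (abs_nonneg z) (abs_nonneg (x - z))]
      calc |g| ≤ A * (1 + |x|) := hg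
        _ ≤ max Aμ Aσ * (1 + |x|) := by gcongr
        _ ≤ max Aμ Aσ * ((1 + |z|) * (1 + |x - z|)) := by gcongr
        _ = max Aμ Aσ * (1 + |z|) * (1 + |x - z|) := by ring
        _ ≤ _ := by
          gcongr
          exact le_max_right _ _
    · right; exact hA
  have hk : ∀ k : Fin m, ∃ C ε0 : ℝ, 0 < C ∧ 0 < ε0 ∧ ε0 ≤ 1 ∧ ∀ n : ℕ, 0 < n →
      T / n < ε0 ^ 2 →
      ∫⁻ ω, (∫⁻ s in Set.Icc (0:ℝ) T,
          if (emProc μ σ ρ W N (T / n) ξ (lastGrid (T / n) s) ω - ζ k)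
              * (emProc μ σ ρ W N (T / n) ξ s ω - ζ k) ≤ 0
            then (1 : ENNReal) else 0) ^ 2 ∂P
        ≤ ENNReal.ofReal (C * (T / n)) := by
    intro k
    obtain ⟨C, ε0, hC, hε0, hε01, hdet⟩ := det_core μ σ hμ_meas hσ_meas (ζ k)
      (max 1 (max Aμ Aσ * (1 + |ζ k|))) gM (le_max_left _ _) gM_ge_one
      (fun x => (hconv Aμ (ζ k) x (μ x) (hAμ x)).resolve_right (not_not.2 (le_max_left _ _)))
      (fun x => (hconv Aσ (ζ k) x (σ x) (hAσ x (Set.mem_univ _))).resolve_right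
        (not_not.2 (le_max_right _ _)))
      hKσ.continuous (hσ_nz k)
    have hgM := gM_ge_one
    refine ⟨T + 2 * ((4 * C * (1 + gM) * (1 + C + lamB) + 2 * C + lamB) * (1 + T)) ^ 2, ε0,
      by positivity, hε0, hε01, ?_⟩
    intro n hn hlt
    have hn' : (0 : ℝ) < n := by exact_mod_cast hn
    have hpos : 0 < T / n := by positivity
    have hsq : Real.sqrt (T / n) ^ 2 = T / n := Real.sq_sqrt hpos.le
    have hs0 : 0 < Real.sqrt (T / n) := Real.sqrt_pos.2 hpos
    have hs1 : Real.sqrt (T / n) < ε0 := by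
      rw [Real.sqrt_lt' hε0]; exact hlt
    obtain ⟨H, f, Hb, hH, hf, hH0, hHb, hf0, hf1, k1, k2⟩ := hdet _ hs0 hs1
    have h := em_single F P T W N hW_adapted hN_adapted hW_cont hN_rc hW_gauss lamB hlamB0 hjump
      h_indep μ σ ρ hμ_meas hσ_meas hρ_meas ξ (ζ k) C (Real.sqrt (T / n)) hC hs0
      (hs1.le.trans hε01) H f Hb hH hf hH0 hHb hf0 hf1 k1 k2 n
      (by rw [hsq]; field_simp)
    rw [hsq] at h
    exact h
  choose Ck εk hC hε hε1 hkk using hk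
  haveI : Nonempty (Fin m) := ⟨⟨0, hm⟩⟩
  obtain ⟨kmin, hkmin⟩ := Finite.exists_min εk
  obtain ⟨kmax, hkmax⟩ := Finite.exists_max Ck
  refine ⟨Ck kmax, hC kmax, εk kmin ^ 2 / 2, ⟨by have := hε kmin; positivity, ?_⟩, ?_⟩
  · nlinarith [hε kmin, hε1 kmin]
  · intro n hn hlt k
    have h1 : T / n < εk k ^ 2 := by
      have h2 : εk kmin ^ 2 ≤ εk k ^ 2 := pow_le_pow_left₀ (hε kmin).le (hkmin k) 2
      have h3 : 0 < εk kmin ^ 2 := pow_pos (hε kmin) 2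
      linarith
    refine (hkk k n hn h1).trans (ENNReal.ofReal_le_ofReal ?_)
    have : 0 ≤ T / n := by positivity
    exact mul_le_mul_of_nonneg_right (hkmax k) this
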